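/- arXiv:1006.0223 — 9 statements merged into one kernel-verified Lean document; each statement's English description precedes it below -/
import Mathlib

section
/- Let R be a commutative ℚ-algebra and let N be a skew-symmetric (2r+1)×(2r+1) matrix over R. Define the vector v ∈ R^{2r+1} by v_j = (−1)^j · Pf(N_{ĵ}), where N_{ĵ} is the 2r×2r skew-symmetric matrix obtained from N by deleting the j-th row and j-th column (rows and columns indexed 1,…,2r+1). Then N·v = 0, i.e. ∑_{j=1}^{2r+1} n_{ij}·(−1)^j·Pf(N_{ĵ}) = 0 for every i. -/
open Matrix

/-- The pfaffian of a `2r × 2r` skew-symmetric matrix over a commutative `ℚ`-algebra,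
defined by `Pf(N) = (1/(r!·2^r))·∑_{σ ∈ S_{2r}} sign(σ)·∏_{i=1}^{r} n_{σ(i),σ(r+i)}`. -/
noncomputable def pfaffian {R : Type*} [CommRing R] [Algebra ℚ R] {r : ℕ}
    (N : Matrix (Fin (2 * r)) (Fin (2 * r)) R) : R :=
  algebraMap ℚ R (1 / ((r.factorial : ℚ) * 2 ^ r)) *
    ∑ σ : Equiv.Perm (Fin (2 * r)),
      ((Equiv.Perm.sign σ : ℤ) : R) *
        ∏ i : Fin r,
          N (σ ⟨i.1, by have := i.isLt; omega⟩) (σ ⟨r + i.1, by have := i.isLt; omega⟩)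

/-- Extend a permutation and a value at `0` to a permutation, using `succAbove`. -/
def pfExt {n : ℕ} (x : Fin (n + 1) × Equiv.Perm (Fin n)) : Equiv.Perm (Fin (n + 1)) :=
  x.1.cycleRange.symm * Equiv.Perm.decomposeFin.symm (0, x.2)

theorem pfExt_zero {n : ℕ} (x : Fin (n + 1) × Equiv.Perm (Fin n)) : pfExt x 0 = x.1 := by
  simp [pfExt]

theorem pfExt_succ {n : ℕ} (x : Fin (n + 1) × Equiv.Perm (Fin n)) (k : Fin n) :
    pfExt x k.succ = x.1.succAbove (x.2 k) := by
  simp [pfExt]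

theorem pfExt_sign {n : ℕ} (x : Fin (n + 1) × Equiv.Perm (Fin n)) :
    Equiv.Perm.sign (pfExt x) = (-1) ^ (x.1 : ℕ) * Equiv.Perm.sign x.2 := by
  simp [pfExt, Equiv.Perm.decomposeFin.symm_sign]

theorem pfExt_bij {n : ℕ} : Function.Bijective (pfExt (n := n)) := by
  rw [Fintype.bijective_iff_injective_and_card]
  refine ⟨?_, (Fintype.card_congr Equiv.Perm.decomposeFin).symm⟩
  intro x y h
  have h1 : x.1 = y.1 := by rw [← pfExt_zero x, h, pfExt_zero]
  refine Prod.ext h1 (Equiv.ext fun k => ?_)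
  have h2 : pfExt x k.succ = pfExt y k.succ := by rw [h]
  rw [pfExt_succ, pfExt_succ, h1] at h2
  exact Fin.succAbove_right_injective h2

/-- First elements of the pairs. -/
def pfA {r : ℕ} (k : Fin r) : Fin (2 * r + 1) := ⟨k.1 + 1, by have := k.isLt; omega⟩
/-- Second elements of the pairs. -/
def pfB {r : ℕ} (k : Fin r) : Fin (2 * r + 1) := ⟨r + k.1 + 1, by have := k.isLt; omega⟩

/-- The partner of a position; `0` is its own partner. -/
def pfQ {r : ℕ} (p : Fin (2 * r + 1)) : Fin (2 * r + 1) :=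
  if p.1 = 0 then 0 else if h : p.1 ≤ r then ⟨p.1 + r, by omega⟩ else ⟨p.1 - r, by omega⟩

theorem pfQ_zero {r : ℕ} : pfQ (0 : Fin (2 * r + 1)) = 0 := by simp [pfQ]

theorem pfQ_A {r : ℕ} (k : Fin r) : pfQ (pfA k) = pfB k := by
  have := k.isLt
  have hv : (pfA k).1 = k.1 + 1 := rfl
  unfold pfQ
  rw [if_neg (by omega), dif_pos (by omega)]
  apply Fin.ext; simp only [pfA, pfB]; omega

theorem pfQ_B {r : ℕ} (k : Fin r) : pfQ (pfB k) = pfA k := by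
  have := k.isLt
  have hv : (pfB k).1 = r + k.1 + 1 := rfl
  unfold pfQ
  rw [if_neg (by omega), dif_neg (by omega)]
  apply Fin.ext; simp only [pfA, pfB]; omega

theorem pf_cases {r : ℕ} (p : Fin (2 * r + 1)) : p = 0 ∨ (∃ k, p = pfA k) ∨ ∃ k, p = pfB k := by
  rcases Nat.eq_zero_or_pos p.1 with h | h
  · left; ext; simpa using h
  · right
    by_cases h2 : p.1 ≤ r
    · left; exact ⟨⟨p.1 - 1, by omega⟩, by ext; simp [pfA]; omega⟩
    · right; exact ⟨⟨p.1 - 1 - r, by omega⟩, by ext; simp [pfB]; omega⟩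

theorem pfA_ne_zero {r : ℕ} (k : Fin r) : pfA k ≠ 0 := by simp [pfA, Fin.ext_iff]
theorem pfB_ne_zero {r : ℕ} (k : Fin r) : pfB k ≠ 0 := by simp [pfB, Fin.ext_iff]
theorem pfA_ne_B {r : ℕ} (k l : Fin r) : pfA k ≠ pfB l := by
  simp only [pfA, pfB, ne_eq, Fin.mk.injEq]; omega
theorem pfA_inj {r : ℕ} {k l : Fin r} (h : k ≠ l) : pfA k ≠ pfA l := by
  simp only [pfA, ne_eq, Fin.mk.injEq]; omega
theorem pfB_inj {r : ℕ} {k l : Fin r} (h : k ≠ l) : pfB k ≠ pfB l := by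
  simp only [pfB, ne_eq, Fin.mk.injEq]; omega

theorem pf_sum_zero {R : Type*} [CommRing R] [Algebra ℚ R] (r : ℕ)
    (N : Matrix (Fin (2 * r + 1)) (Fin (2 * r + 1)) R) (hN : Nᵀ = -N) (i : Fin (2 * r + 1)) :
    ∑ τ : Equiv.Perm (Fin (2 * r + 1)), ((Equiv.Perm.sign τ : ℤ) : R) *
      (N i (τ 0) * ∏ k : Fin r, N (τ (pfA k)) (τ (pfB k))) = 0 := by
  have hs : ∀ a b, N a b = - N b a := fun a b => by
    have := congrFun (congrFun hN b) a
    simpa using this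
  have hd : N i i = 0 := by
    have h := hs i i
    have h2 : (2 : R) * N i i = 0 := by linear_combination h
    have h3 : algebraMap ℚ R (1/2) * 2 = 1 := by
      rw [show (2 : R) = algebraMap ℚ R 2 from (map_ofNat (algebraMap ℚ R) 2).symm, ← map_mul]; norm_num
    calc N i i = (algebraMap ℚ R (1/2) * 2) * N i i := by rw [h3, one_mul]
      _ = 0 := by rw [mul_assoc, h2, mul_zero]
  have key : ∀ (τ : Equiv.Perm (Fin (2 * r + 1))) (p : Fin (2 * r + 1)), τ p = i → p ≠ 0 →
      pfQ p ≠ 0 ∧ pfQ p ≠ p ∧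
      N i (τ (pfQ p)) * ∏ k : Fin r, N (τ (Equiv.swap 0 (pfQ p) (pfA k)))
          (τ (Equiv.swap 0 (pfQ p) (pfB k)))
        = N i (τ 0) * ∏ k : Fin r, N (τ (pfA k)) (τ (pfB k)) := by
    intro τ p hp h0
    rcases pf_cases p with h | ⟨k, rfl⟩ | ⟨k, rfl⟩
    · exact absurd h h0
    · rw [pfQ_A]
      refine ⟨pfB_ne_zero k, (pfA_ne_B k k).symm, ?_⟩
      rw [← Finset.mul_prod_erase _ _ (Finset.mem_univ k),
        ← Finset.mul_prod_erase Finset.univ (fun k => N (τ (pfA k)) (τ (pfB k)))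
          (Finset.mem_univ k)]
      rw [Finset.prod_congr rfl (g := fun k => N (τ (pfA k)) (τ (pfB k)))]
      · rw [Equiv.swap_apply_right, Equiv.swap_apply_of_ne_of_ne (pfA_ne_zero k) (pfA_ne_B k k), hp]
        ring
      · intro l hl
        have hl := Finset.ne_of_mem_erase hl
        rw [Equiv.swap_apply_of_ne_of_ne (pfA_ne_zero l) (pfA_ne_B l k),
          Equiv.swap_apply_of_ne_of_ne (pfB_ne_zero l) (pfB_inj hl)]
    · rw [pfQ_B]
      refine ⟨pfA_ne_zero k, (pfA_ne_B k k), ?_⟩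
      rw [← Finset.mul_prod_erase _ _ (Finset.mem_univ k),
        ← Finset.mul_prod_erase Finset.univ (fun k => N (τ (pfA k)) (τ (pfB k)))
          (Finset.mem_univ k)]
      rw [Finset.prod_congr rfl (g := fun k => N (τ (pfA k)) (τ (pfB k)))]
      · rw [Equiv.swap_apply_right,
          Equiv.swap_apply_of_ne_of_ne (pfB_ne_zero k) (pfA_ne_B k k).symm, hp,
          hs (τ 0) i, hs (τ (pfA k)) i]
        ring
      · intro l hl
        have hl := Finset.ne_of_mem_erase hl
        rw [Equiv.swap_apply_of_ne_of_ne (pfA_ne_zero l) (pfA_inj hl),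
          Equiv.swap_apply_of_ne_of_ne (pfB_ne_zero l) (pfA_ne_B k l).symm]
  refine Finset.sum_involution (fun τ _ => τ * Equiv.swap 0 (pfQ (τ⁻¹ i))) ?_ ?_ ?_ ?_
  · intro τ _
    have hp : τ (τ⁻¹ i) = i := by simp
    generalize τ⁻¹ i = p at hp
    by_cases h0 : p = 0
    · subst h0
      simp [pfQ_zero, hp, hd]
    · obtain ⟨h1, h2, h3⟩ := key τ p hp h0
      simp only [Equiv.Perm.mul_apply, Equiv.swap_apply_left, Equiv.Perm.sign_mul,
        Equiv.Perm.sign_swap h1.symm]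
      rw [h3]
      simp
  · intro τ _ hne heq
    have hp : τ (τ⁻¹ i) = i := by simp
    generalize τ⁻¹ i = p at hp heq
    by_cases h0 : p = 0
    · subst h0
      simp [hp, hd] at hne
    · obtain ⟨h1, h2, h3⟩ := key τ p hp h0
      have := congrArg (fun s => s 0) heq
      simp only [Equiv.Perm.mul_apply, Equiv.swap_apply_left] at this
      exact h1 (τ.injective this)
  · intros; exact Finset.mem_univ _
  · intro τ _
    have hp : τ (τ⁻¹ i) = i := by simp
    have hq : (τ * Equiv.swap 0 (pfQ (τ⁻¹ i)))⁻¹ i = τ⁻¹ i := by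
      rw [Equiv.Perm.inv_eq_iff_eq]
      generalize τ⁻¹ i = p at hp
      by_cases h0 : p = 0
      · subst h0
        simp [pfQ_zero, hp]
      · obtain ⟨h1, h2, h3⟩ := key τ p hp h0
        rw [Equiv.Perm.mul_apply, Equiv.swap_apply_of_ne_of_ne h0 h2.symm, hp]
    simp only [hq]
    rw [mul_assoc, Equiv.swap_mul_self, mul_one]

/-- For a skew-symmetric `(2r+1) × (2r+1)` matrix `N` over a commutative `ℚ`-algebra,
the vector `v` with `v_j = (−1)^j · Pf(N_ĵ)` (where `N_ĵ` deletes the `j`-th row and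
column, and rows and columns are indexed `1, …, 2r+1`) satisfies `N · v = 0`. -/
theorem mulVec_pfaffian_deleted_eq_zero {R : Type*} [CommRing R] [Algebra ℚ R] (r : ℕ)
    (N : Matrix (Fin (2 * r + 1)) (Fin (2 * r + 1)) R) (hN : Nᵀ = -N) :
    N.mulVec (fun j => (-1 : R) ^ (j.1 + 1) *
      pfaffian (N.submatrix j.succAbove j.succAbove)) = 0 := by
  funext i
  have h := pf_sum_zero r N hN i
  rw [← pfExt_bij.sum_comp, Fintype.sum_prod_type] at h
  rw [Pi.zero_apply]
  refine Eq.trans ?_ ((congrArg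
    (fun x => - algebraMap ℚ R (1 / ((r.factorial : ℚ) * 2 ^ r)) * x) h).trans (mul_zero _))
  rw [Matrix.mulVec, dotProduct, Finset.mul_sum]
  refine Finset.sum_congr rfl fun j _ => ?_
  rw [pfaffian, Finset.mul_sum, Finset.mul_sum, Finset.mul_sum, Finset.mul_sum]
  refine Finset.sum_congr rfl fun σ _ => ?_
  have hA : ∀ k : Fin r, pfExt (j, σ) (pfA k)
      = j.succAbove (σ ⟨k.1, by have := k.isLt; omega⟩) := fun k => pfExt_succ (j, σ) ⟨k.1, by have := k.isLt; omega⟩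
  have hB : ∀ k : Fin r, pfExt (j, σ) (pfB k)
      = j.succAbove (σ ⟨r + k.1, by have := k.isLt; omega⟩) := fun k => pfExt_succ (j, σ) ⟨r + k.1, by have := k.isLt; omega⟩
  simp only [hA, hB, pfExt_zero, pfExt_sign, Matrix.submatrix_apply]
  push_cast
  ring
end

section
/- Let K be a field of characteristic zero and let N be a skew-symmetric (2r+1)×(2r+1) matrix over K. Define v ∈ K^{2r+1} by v_j = (−1)^j·Pf(N_{ĵ}). If v ≠ 0, then the kernel of the linear map K^{2r+1} → K^{2r+1} given by N is exactly the one-dimensional span of v; in particular N has rank 2r. -/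
open Matrix

def pT {K : Type*} [Field K] {r : ℕ} (N : Matrix (Fin (2 * r + 1)) (Fin (2 * r + 1)) K)
    (w : Fin (2 * r + 1) → K) (I : Fin (2 * r + 1) → Fin (2 * r + 1)) : K :=
  w (I 0) * ∏ i : Fin r, N (I (Fin.succ ⟨i.1, by have := i.isLt; omega⟩))
    (I (Fin.succ ⟨r + i.1, by have := i.isLt; omega⟩))

noncomputable def pM {K : Type*} [Field K] {r : ℕ}
    (N : Matrix (Fin (2 * r + 1)) (Fin (2 * r + 1)) K) (w : Fin (2 * r + 1) → K) :
    MultilinearMap K (fun _ : Fin (2 * r + 1) => (Fin (2 * r + 1) → K)) K :=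
  ∑ I : Fin (2 * r + 1) → Fin (2 * r + 1), pT N w I •
    (MultilinearMap.mkPiAlgebra K (Fin (2 * r + 1)) K).compLinearMap
      (fun a => LinearMap.proj (I a))

theorem pM_apply {K : Type*} [Field K] {r : ℕ}
    (N : Matrix (Fin (2 * r + 1)) (Fin (2 * r + 1)) K) (w : Fin (2 * r + 1) → K)
    (x : Fin (2 * r + 1) → Fin (2 * r + 1) → K) :
    pM N w x = ∑ I : Fin (2 * r + 1) → Fin (2 * r + 1), pT N w I * ∏ a, x a (I a) := by
  simp [pM]

theorem pM_single {K : Type*} [Field K] {r : ℕ}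
    (N : Matrix (Fin (2 * r + 1)) (Fin (2 * r + 1)) K) (w : Fin (2 * r + 1) → K)
    (J : Fin (2 * r + 1) → Fin (2 * r + 1)) :
    pM N w (fun a => Pi.single (J a) 1) = pT N w J := by
  rw [pM_apply, Finset.sum_eq_single J]
  · simp
  · intro I _ hI
    obtain ⟨a, ha⟩ := Function.ne_iff.mp hI
    rw [Finset.prod_eq_zero (Finset.mem_univ a), mul_zero]
    simp [ha]
  · simp

theorem pT_contract {K : Type*} [Field K] {r : ℕ}
    (N : Matrix (Fin (2 * r + 1)) (Fin (2 * r + 1)) K) (w u : Fin (2 * r + 1) → K)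
    (h1 : ∀ q, ∑ p, N p q * u p = 0) (h2 : ∀ q, ∑ p, N q p * u p = 0)
    (hw : ∑ p, w p * u p = 0)
    (I : Fin (2 * r + 1) → Fin (2 * r + 1)) (a : Fin (2 * r + 1)) :
    ∑ p, pT N w (Function.update I a p) * u p = 0 := by
  have key : ∃ (c : K) (g : Fin (2 * r + 1) → K), ∑ p, g p * u p = 0 ∧
      ∀ p, pT N w (Function.update I a p) = c * g p := by
    rcases Fin.eq_zero_or_eq_succ a with rfl | ⟨b, rfl⟩
    · refine ⟨∏ i : Fin r, N (I (Fin.succ ⟨i.1, by have := i.isLt; omega⟩))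
        (I (Fin.succ ⟨r + i.1, by have := i.isLt; omega⟩)), w, hw, fun p => ?_⟩
      simp [pT, mul_comm]
    · by_cases hb : b.1 < r
      · set i₀ : Fin r := ⟨b.1, hb⟩ with hi
        refine ⟨w (I 0) * ∏ i ∈ Finset.univ.erase i₀,
          N (I (Fin.succ ⟨i.1, by have := i.isLt; omega⟩))
          (I (Fin.succ ⟨r + i.1, by have := i.isLt; omega⟩)),
          fun p => N p (I (Fin.succ ⟨r + i₀.1, by have := i₀.isLt; omega⟩)), h1 _, fun p => ?_⟩
        rw [pT, Function.update_of_ne (Fin.succ_ne_zero _).symm,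
          ← Finset.mul_prod_erase _ _ (Finset.mem_univ i₀), mul_assoc,
          mul_comm (∏ _ ∈ _, _)]
        congr 2
        · rw [Function.update_of_ne (a := Fin.succ ⟨r + i₀.1, _⟩)]
          · congr 1
            exact Function.update_self _ _ _
          · intro h
            have := congrArg Fin.val (Fin.succ_injective _ h)
            simp [hi] at this; omega
        · refine Finset.prod_congr rfl fun i hi' => ?_
          have hne := Finset.ne_of_mem_erase hi'
          rw [Function.update_of_ne, Function.update_of_ne]
          · intro h
            have := congrArg Fin.val (Fin.succ_injective _ h)
            simp at this; omega
          · intro h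
            have := congrArg Fin.val (Fin.succ_injective _ h)
            exact hne (Fin.ext this)
      · set i₀ : Fin r := ⟨b.1 - r, by omega⟩ with hi
        refine ⟨w (I 0) * ∏ i ∈ Finset.univ.erase i₀,
          N (I (Fin.succ ⟨i.1, by have := i.isLt; omega⟩))
          (I (Fin.succ ⟨r + i.1, by have := i.isLt; omega⟩)),
          fun p => N (I (Fin.succ ⟨i₀.1, by have := i₀.isLt; omega⟩)) p, h2 _, fun p => ?_⟩
        rw [pT, Function.update_of_ne (Fin.succ_ne_zero _).symm,
          ← Finset.mul_prod_erase _ _ (Finset.mem_univ i₀), mul_assoc,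
          mul_comm (∏ _ ∈ _, _)]
        have hb' : b = ⟨r + i₀.1, by omega⟩ := Fin.ext (by simp [hi]; omega)
        congr 2
        · rw [Function.update_of_ne (a := Fin.succ ⟨i₀.1, _⟩)]
          · congr 1
            rw [← hb']
            exact Function.update_self _ _ _
          · intro h
            have := congrArg Fin.val (Fin.succ_injective _ h)
            simp [hi] at this; omega
        · refine Finset.prod_congr rfl fun i hi' => ?_
          have hne := Finset.ne_of_mem_erase hi'
          rw [Function.update_of_ne, Function.update_of_ne]
          · intro h
            have := congrArg Fin.val (Fin.succ_injective _ h)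
            refine hne (Fin.ext ?_)
            simp [hi] at this ⊢; omega
          · intro h
            have := congrArg Fin.val (Fin.succ_injective _ h)
            simp at this; omega
  obtain ⟨c, g, hg, h⟩ := key
  simp_rw [h, mul_assoc, ← Finset.mul_sum, hg, mul_zero]

theorem pM_eq_zero {K : Type*} [Field K] {r : ℕ}
    (N : Matrix (Fin (2 * r + 1)) (Fin (2 * r + 1)) K) (w u : Fin (2 * r + 1) → K)
    (h1 : ∀ q, ∑ p, N p q * u p = 0) (h2 : ∀ q, ∑ p, N q p * u p = 0)
    (hw : ∑ p, w p * u p = 0)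
    (x : Fin (2 * r + 1) → Fin (2 * r + 1) → K) (a : Fin (2 * r + 1)) (hx : x a = u) :
    pM N w x = 0 := by
  rw [pM_apply, ← (Fin.insertNthEquiv (fun _ => Fin (2 * r + 1)) a).sum_comp,
    Fintype.sum_prod_type_right]
  refine Finset.sum_eq_zero fun J _ => ?_
  have h := pT_contract N w u h1 h2 hw (a.insertNth a J) a
  simp only [Fin.update_insertNth] at h
  simp only [Fin.insertNthEquiv_apply, Fin.prod_univ_succAbove _ a, Fin.insertNth_apply_same,
    Fin.insertNth_apply_succAbove, hx, ← mul_assoc]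
  rw [← Finset.sum_mul]
  exact (congrArg (· * _) h).trans (zero_mul _)

def pPhi {K : Type*} [Field K] {r : ℕ}
    (N : Matrix (Fin (2 * r + 1)) (Fin (2 * r + 1)) K) (w : Fin (2 * r + 1) → K) : K :=
  ∑ σ : Equiv.Perm (Fin (2 * r + 1)), ((Equiv.Perm.sign σ : ℤ) : K) * pT N w σ

theorem pPhi_eq_zero {K : Type*} [Field K] {r : ℕ}
    (N : Matrix (Fin (2 * r + 1)) (Fin (2 * r + 1)) K) (w u : Fin (2 * r + 1) → K)
    (h1 : ∀ q, ∑ p, N p q * u p = 0) (h2 : ∀ q, ∑ p, N q p * u p = 0)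
    (hw : ∑ p, w p * u p = 0) (hu : u ≠ 0) : pPhi N w = 0 := by
  obtain ⟨k, hk⟩ := Function.ne_iff.mp hu
  set f := MultilinearMap.alternatization (pM N w) with hf
  have hfe : f (fun a => Pi.single a 1) = pPhi N w := by
    rw [hf, MultilinearMap.alternatization_apply, pPhi]
    refine Finset.sum_congr rfl fun σ _ => ?_
    rw [← pM_single]
    simp [Units.smul_def, MultilinearMap.domDomCongr_apply]
  have h0 : f (Function.update (fun a => Pi.single a 1) k u) = 0 := by
    rw [hf, MultilinearMap.alternatization_apply]
    refine Finset.sum_eq_zero fun σ _ => ?_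
    rw [MultilinearMap.domDomCongr_apply, pM_eq_zero N w u h1 h2 hw _ (σ.symm k) (by simp),
      smul_zero]
  have hu' : u = ∑ j, u j • (Pi.single j 1 : Fin (2 * r + 1) → K) := by
    ext i; simp [Finset.sum_apply, Pi.single_apply]
  rw [hu', f.map_update_sum, Finset.sum_eq_single k] at h0
  · rw [f.map_update_smul, Function.update_eq_self, hfe, smul_eq_mul] at h0
    exact (mul_eq_zero.mp h0).resolve_left hk
  · intro j _ hj
    rw [f.map_update_smul]
    rw [f.map_update_self _ hj.symm, smul_zero]
  · simp

theorem pPhi_single {K : Type*} [Field K] {r : ℕ}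
    (N : Matrix (Fin (2 * r + 1)) (Fin (2 * r + 1)) K) (j : Fin (2 * r + 1)) :
    pPhi N (Pi.single j 1) = (-1) ^ j.1 * ∑ σ : Equiv.Perm (Fin (2 * r)),
      ((Equiv.Perm.sign σ : ℤ) : K) *
        ∏ i : Fin r,
          (N.submatrix j.succAbove j.succAbove)
            (σ ⟨i.1, by have := i.isLt; omega⟩) (σ ⟨r + i.1, by have := i.isLt; omega⟩) := by
  rw [pPhi, ← Equiv.sum_comp (Equiv.mulLeft (Fin.cycleRange j)⁻¹),
    ← Equiv.Perm.decomposeFin.symm.sum_comp, Fintype.sum_prod_type, Finset.sum_eq_single 0]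
  · rw [Finset.mul_sum]
    refine Finset.sum_congr rfl fun e _ => ?_
    simp [pT, Fin.sign_cycleRange, Equiv.Perm.inv_def, mul_assoc, -Fin.succ_mk,
      Equiv.Perm.decomposeFin.symm_sign]
  · intro p _ hp
    refine Finset.sum_eq_zero fun e _ => ?_
    have : (Fin.cycleRange j).symm p ≠ j := by
      intro h
      rw [Equiv.symm_apply_eq, Fin.cycleRange_self] at h
      exact hp h
    simp [pT, Equiv.Perm.inv_def, this]
  · simp

theorem pPhi_lin {K : Type*} [Field K] {r : ℕ}
    (N : Matrix (Fin (2 * r + 1)) (Fin (2 * r + 1)) K) (w w' : Fin (2 * r + 1) → K) (a b : K) :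
    pPhi N (a • w - b • w') = a * pPhi N w - b * pPhi N w' := by
  simp only [pPhi, pT, Finset.mul_sum, ← Finset.sum_sub_distrib]
  refine Finset.sum_congr rfl fun σ _ => ?_
  simp only [Pi.sub_apply, Pi.smul_apply, smul_eq_mul]
  ring

/-- Let `N` be a skew-symmetric `(2r+1) × (2r+1)` matrix over a field `K` of
characteristic zero, and let `v_j = (−1)^j · Pf(N_ĵ)`.  If `v ≠ 0`, then the kernel of
the linear map given by `N` is exactly the span of `v`; in particular `N` has rank `2r`. -/
theorem ker_eq_span_pfaffian_vector {K : Type*} [Field K] [CharZero K] (r : ℕ)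
    (N : Matrix (Fin (2 * r + 1)) (Fin (2 * r + 1)) K) (hN : Nᵀ = -N)
    (v : Fin (2 * r + 1) → K)
    (hv : v = fun j => (-1 : K) ^ (j.1 + 1) *
      pfaffian (N.submatrix j.succAbove j.succAbove))
    (hv0 : v ≠ 0) :
    LinearMap.ker N.mulVecLin = Submodule.span K {v} ∧ N.rank = 2 * r := by
  obtain ⟨c, hc⟩ : ∃ c : K, ∀ j, v j = c * pPhi N (Pi.single j 1) := by
    refine ⟨-algebraMap ℚ K (1 / ((r.factorial : ℚ) * 2 ^ r)), fun j => ?_⟩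
    rw [pPhi_single, hv]
    simp only [pfaffian]
    ring
  have main : ∀ u : Fin (2 * r + 1) → K, u ≠ 0 → N *ᵥ u = 0 → ∀ i j, u i * v j = u j * v i := by
    intro u hu hNu i j
    have h2 : ∀ q, ∑ p, N q p * u p = 0 := fun q => congrFun hNu q
    have h1 : ∀ q, ∑ p, N p q * u p = 0 := fun q => by
      have hs : ∀ p, N p q = - N q p := fun p => congrFun (congrFun hN q) p
      simp_rw [hs, neg_mul, Finset.sum_neg_distrib, h2, neg_zero]
    have h := pPhi_eq_zero N (u i • Pi.single j 1 - u j • Pi.single i 1) u h1 h2 (by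
      simp [sub_mul, Finset.sum_sub_distrib, Pi.single_apply]; ring) hu
    rw [pPhi_lin] at h
    rw [hc, hc]
    linear_combination c * h
  obtain ⟨k, hk⟩ := Function.ne_iff.mp hv0
  have hk : v k ≠ 0 := hk
  have hdet : N.det = 0 := by
    have h := congrArg Matrix.det hN
    rw [Matrix.det_transpose, Matrix.det_neg, Fintype.card_fin, pow_succ, pow_mul] at h
    simp at h
    exact self_eq_neg.mp h
  obtain ⟨u, hu, hNu⟩ := Matrix.exists_mulVec_eq_zero_iff.mpr hdet
  have hker : LinearMap.ker N.mulVecLin = Submodule.span K {v} := by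
    have hsp : ∀ x : Fin (2 * r + 1) → K, x ≠ 0 → N *ᵥ x = 0 → x = (x k / v k) • v := by
      intro x hx hNx
      ext i
      have := main x hx hNx i k
      simp only [Pi.smul_apply, smul_eq_mul]
      field_simp
      exact this
    apply le_antisymm
    · intro x hx
      rw [LinearMap.mem_ker, Matrix.mulVecLin_apply] at hx
      by_cases hx0 : x = 0
      · rw [hx0]; exact Submodule.zero_mem _
      · exact Submodule.mem_span_singleton.mpr ⟨_, (hsp x hx0 hx).symm⟩
    · rw [Submodule.span_singleton_le_iff_mem, LinearMap.mem_ker, Matrix.mulVecLin_apply]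
      have h := hsp u hu hNu
      have hne : u k / v k ≠ 0 := by
        intro h0
        rw [h0, zero_smul] at h
        exact hu h
      rw [h, Matrix.mulVec_smul] at hNu
      exact (smul_eq_zero.mp hNu).resolve_left hne
  refine ⟨hker, ?_⟩
  have hr := LinearMap.finrank_range_add_finrank_ker N.mulVecLin
  rw [hker, finrank_span_singleton hv0, Module.finrank_fin_fun] at hr
  rw [Matrix.rank]
  omega
end

section
/- For every natural number n, ∑_{k=0}^{n} ∑_{l=0}^{n−k} C(2n+k, n)·C(n+k, n)·C(n, k)·C(n−k, l)·C(2n, n−l)·C(n+l, k+l) = C(2n, n)² · ∑_{k=0}^{n} C(2n+k, n)·C(n, k)². -/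
theorem aux_term (n k l : ℕ) (hk : k ≤ n) (hl : l ≤ n - k) :
    (2 * n).choose (n - l) * (n + l).choose (k + l) =
      (2 * n).choose (n - k) * (n + k).choose (n - l) := by
  have h1 : (2 * n).choose (n - l) = (2 * n).choose (n + l) :=
    Nat.choose_symm_of_eq_add (by omega)
  have h2 : (n + l).choose (k + l) = (n + l).choose (n - k) :=
    Nat.choose_symm_of_eq_add (by omega)
  have h3 : (n + k).choose (n - l) = (n + k).choose (k + l) :=
    Nat.choose_symm_of_eq_add (by omega)
  rw [h1, h2, h3, Nat.choose_mul (by omega)]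
  congr 2 <;> omega

theorem aux_outer (n k : ℕ) (hk : k ≤ n) :
    (n + k).choose n * (2 * n).choose (n - k) = (2 * n).choose n * n.choose k := by
  have h1 : (2 * n).choose (n - k) = (2 * n).choose (n + k) :=
    Nat.choose_symm_of_eq_add (by omega)
  rw [h1, mul_comm, Nat.choose_mul (by omega)]
  congr 2 <;> omega

theorem aux_vandermonde (n k : ℕ) (hk : k ≤ n) :
    ∑ l ∈ Finset.range (n - k + 1), (n - k).choose l * (n + k).choose (n - l) =
      (2 * n).choose n := by
  have h := Nat.add_choose_eq (n - k) (n + k) n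
  rw [Finset.Nat.sum_antidiagonal_eq_sum_range_succ_mk] at h
  rw [show 2 * n = n - k + (n + k) by omega, h]
  apply Finset.sum_subset
  · intro x hx
    simp only [Finset.mem_range] at *
    omega
  · intro x _ hx
    simp only [Finset.mem_range] at hx
    rw [Nat.choose_eq_zero_of_lt (by omega), zero_mul]


/-- For every natural number `n`,
`∑_{k=0}^{n} ∑_{l=0}^{n−k} C(2n+k,n)·C(n+k,n)·C(n,k)·C(n−k,l)·C(2n,n−l)·C(n+l,k+l)
  = C(2n,n)² · ∑_{k=0}^{n} C(2n+k,n)·C(n,k)²`. -/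
theorem double_sum_choose_identity (n : ℕ) :
    (∑ k ∈ Finset.range (n + 1), ∑ l ∈ Finset.range (n - k + 1),
      (2 * n + k).choose n * (n + k).choose n * n.choose k * (n - k).choose l *
        (2 * n).choose (n - l) * (n + l).choose (k + l)) =
    ((2 * n).choose n) ^ 2 *
      ∑ k ∈ Finset.range (n + 1), (2 * n + k).choose n * (n.choose k) ^ 2 := by
  rw [Finset.mul_sum]
  refine Finset.sum_congr rfl fun k hk => ?_
  have hk' : k ≤ n := by simp only [Finset.mem_range] at hk; omega
  calc _ = ∑ l ∈ Finset.range (n - k + 1),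
        ((2 * n + k).choose n * n.choose k * ((n + k).choose n * (2 * n).choose (n - k))) *
          ((n - k).choose l * (n + k).choose (n - l)) := by
        refine Finset.sum_congr rfl fun l hl => ?_
        have hl' : l ≤ n - k := by simp only [Finset.mem_range] at hl; omega
        rw [mul_assoc, aux_term n k l hk' hl']
        ring
    _ = _ := by
        rw [← Finset.mul_sum, aux_vandermonde n k hk', aux_outer n k hk']
        ring
end

section
/- Let M be the 6×9 integer matrix whose columns (indexed by (i,j), i,j ∈ {1,2,3}, in the order (1,1),(1,2),(1,3),(2,1),(2,2),(2,3),(3,1),(3,2),(3,3)) are the vectors (0,0,−1,−1,2,1), (0,0,−1,−1,1,2), (1,2,−1,−1,0,0), (−1,0,0,0,−1,−1), (−1,2,1,0,−1,−1), (−1,2,0,1,−1,−1), (0,−1,2,1,−1,−1), (0,−1,1,2,−1,−1), (1,−1,0,0,−1,−1). Let u₁ = e_{11}+e_{12}+e_{23}+e_{31}+e_{33}, u₂ = e_{11}+e_{12}+e_{22}+e_{32}+e_{33}, u₃ = e_{11}+e_{12}+e_{13}+e_{21}+e_{31}+e_{32} ∈ ℕ⁹ (where e_{ij} is the standard basis vector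 at column (i,j)). Then a vector n ∈ ℕ⁹ satisfies M·n = 0 if and only if there exist a, b, c ∈ ℕ with n = a·u₁ + b·u₂ + c·u₃, and this representation (a,b,c) is unique. -/
/-- The `6 × 9` integer matrix whose columns, indexed by `(i,j)` with `i,j ∈ {1,2,3}` in
the order `(1,1),(1,2),(1,3),(2,1),(2,2),(2,3),(3,1),(3,2),(3,3)`, are the exponent
vectors of the nine Laurent monomials `a_{i,j}` arising in the period integral of the
degree 13 pfaffian mirror family. -/
def expMatrix : Matrix (Fin 6) (Fin 9) ℤ :=
  !![0, 0, 1, -1, -1, -1, 0, 0, 1;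
     0, 0, 2, 0, 2, 2, -1, -1, -1;
     -1, -1, -1, 0, 1, 0, 2, 1, 0;
     -1, -1, -1, 0, 0, 1, 1, 2, 0;
     2, 1, 0, -1, -1, -1, -1, -1, -1;
     1, 2, 0, -1, -1, -1, -1, -1, -1]

/-- `u₁ = e₁₁ + e₁₂ + e₂₃ + e₃₁ + e₃₃`. -/
def u₁ : Fin 9 → ℕ := ![1, 1, 0, 0, 0, 1, 1, 0, 1]

/-- `u₂ = e₁₁ + e₁₂ + e₂₂ + e₃₂ + e₃₃`. -/
def u₂ : Fin 9 → ℕ := ![1, 1, 0, 0, 1, 0, 0, 1, 1]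

/-- `u₃ = e₁₁ + e₁₂ + e₁₃ + e₂₁ + e₃₁ + e₃₂`. -/
def u₃ : Fin 9 → ℕ := ![1, 1, 1, 1, 0, 0, 1, 1, 0]

/-- A vector `n ∈ ℕ⁹` satisfies `M·n = 0` if and only if it can be written as
`a·u₁ + b·u₂ + c·u₃` with `a, b, c ∈ ℕ`, and this representation is unique. -/
theorem mulVec_eq_zero_iff_unique_rep (n : Fin 9 → ℕ) :
    expMatrix.mulVec (fun j => (n j : ℤ)) = 0 ↔
      ∃! abc : ℕ × ℕ × ℕ, n = abc.1 • u₁ + abc.2.1 • u₂ + abc.2.2 • u₃ := by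
  have key : expMatrix.mulVec (fun j => (n j : ℤ)) = 0 ↔
      ∃ a b c : ℕ, n = a • u₁ + b • u₂ + c • u₃ := by
    constructor
    · intro h
      refine ⟨n 5, n 4, n 3, ?_⟩
      have h0 := congrFun h 0
      have h1 := congrFun h 1
      have h2 := congrFun h 2
      have h3 := congrFun h 3
      have h4 := congrFun h 4
      have h5 := congrFun h 5
      simp [expMatrix, Matrix.mulVec, dotProduct, Fin.sum_univ_succ] at h0 h1 h2 h3 h4 h5
      ext i
      fin_cases i <;> simp [u₁, u₂, u₃] <;> omega
    · rintro ⟨a, b, c, rfl⟩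
      ext i
      fin_cases i <;>
        simp [expMatrix, Matrix.mulVec, dotProduct, Fin.sum_univ_succ, u₁, u₂, u₃] <;> ring
  rw [key]
  constructor
  · rintro ⟨a, b, c, rfl⟩
    refine ⟨(a, b, c), rfl, ?_⟩
    rintro ⟨a', b', c'⟩ h
    have h3 := congrFun h 3
    have h4 := congrFun h 4
    have h5 := congrFun h 5
    simp [u₁, u₂, u₃] at h3 h4 h5
    simp [h3, h4, h5]
  · rintro ⟨⟨a, b, c⟩, h, -⟩
    exact ⟨a, b, c, h⟩
end

section
/- Define A : ℕ → ℚ by A_n = C(2n, n)² · ∑_{k=0}^{n} C(2n+k, n)·C(n, k)², and extend A by A_m = 0 for m < 0. Then for every integer n ≥ 1, 169·n⁴·A_n = q₁(n−1)·A_{n−1} − 16·q₂(n−2)·A_{n−2} − 256·q₃(n−3)·A_{n−3} + 4096·(2n−7)⁴·A_{n−4}, where q₁(m) = 59397m⁴ + 117546m³ + 86827m² + 28054m + 3380, q₂(m) = 6386m⁴ − 1774m³ − 17898m² − 11596m − 2119, and q₃(m) = 67m⁴ + 1248m³ + 1091m² + 312m + 26. Equivalently, the formal power series ∑_{n≥0}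 A_n φⁿ is annihilated by the Picard–Fuchs operator 13²Θ⁴ − φ·q₁(Θ) + 2⁴φ²·q₂(Θ) + 2⁸φ³·q₃(Θ) − 2¹²φ⁴(2Θ+1)⁴ with Θ = φ·d/dφ. -/
/-- The coefficients `A_n = C(2n,n)²·∑_{k=0}^n C(2n+k,n)·C(n,k)²` of the fundamental
period of the mirror family of the degree 13 pfaffian Calabi–Yau threefold, extended by
`0` to negative indices. -/
def A13 : ℤ → ℚ
  | Int.ofNat n =>
      (((2 * n).choose n : ℚ)) ^ 2 *
        ∑ k ∈ Finset.range (n + 1), (((2 * n + k).choose n : ℚ)) * ((n.choose k : ℚ)) ^ 2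
  | Int.negSucc _ => 0

set_option linter.unusedTactic false

/-- Coefficient of `k ^ 0` in the certificate polynomial. -/
def cert0 (n : ℚ) : ℚ :=
  (((((((((((((((-24054048) * n + (-791661168)) * n + (-11920847712)) * n + (-108772744512)) * n + (-671325216480)) * n + (-2961772166160)) * n + (-9621921227976)) * n + (-23353282402956)) * n + (-42488324705460)) * n + (-57559710774984)) * n + (-57025729458180)) * n + (-39948374503692)) * n + (-18633473228592)) * n + (-5151974167728)) * n + (-631959682752))

/-- Coefficient of `k ^ 1` in the certificate polynomial. -/
def cert1 (n : ℚ) : ℚ :=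
  ((((((((((((((-74756208) * n + (-2340021440)) * n + (-33290103120)) * n + (-284837753328)) * n + (-1634315462952)) * n + (-6635554413136)) * n + (-19597156413028)) * n + (-42585263364116)) * n + (-68011617606022)) * n + (-78736684128052)) * n + (-64117534133524)) * n + (-34704516013566)) * n + (-11158842547404)) * n + (-1603409425344))

/-- Coefficient of `k ^ 2` in the certificate polynomial. -/
def cert2 (n : ℚ) : ℚ :=
  (((((((((((((-80661056) * n + (-2461193360)) * n + (-33724122528)) * n + (-274509245136)) * n + (-1478613313608)) * n + (-5552102820920)) * n + (-14899590771694)) * n + (-28783121055467)) * n + (-39705811196402)) * n + (-38119129248750)) * n + (-24153792412747)) * n + (-9058958781156)) * n + (-1518387906492))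

/-- Coefficient of `k ^ 3` in the certificate polynomial. -/
def cert3 (n : ℚ) : ℚ :=
  ((((((((((((-21163232) * n + (-784176656)) * n + (-11865450120)) * n + (-100591176992)) * n + (-540678145184)) * n + (-1954083184832)) * n + (-4874486745051)) * n + (-8424143184544)) * n + (-9908895803528)) * n + (-7567402636128)) * n + (-3380639217547)) * n + (-669716168574))

/-- Coefficient of `k ^ 4` in the certificate polynomial. -/
def cert4 (n : ℚ) : ℚ :=
  (((((((((((26214400) * n + (477046144)) * n + (3455492856)) * n + (11363696336)) * n + (4873521990)) * n + (-97926370137)) * n + (-388920730182)) * n + (-748052148701)) * n + (-817574257036)) * n + (-486702014570)) * n + (-122990156628))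

/-- Coefficient of `k ^ 5` in the certificate polynomial. -/
def cert5 (n : ℚ) : ℚ :=
  ((((((((((24329008) * n + (485883664)) * n + (4185979416)) * n + (20352648000)) * n + (61239041205)) * n + (117309707120)) * n + (141118448943)) * n + (100129988212)) * n + (35761903776)) * n + (3953394468))

/-- Coefficient of `k ^ 6` in the certificate polynomial. -/
def cert6 (n : ℚ) : ℚ :=
  (((((((((7635712) * n + (149983552)) * n + (1250090016)) * n + (5788278520)) * n + (16308910240)) * n + (28657366247)) * n + (30681100103)) * n + (18302605038)) * n + (4658540436))

/-- Coefficient of `k ^ 7` in the certificate polynomial. -/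
def cert7 (n : ℚ) : ℚ :=
  ((((((((624112) * n + (13846576)) * n + (118210608)) * n + (523327088)) * n + (1322528037)) * n + (1928840050)) * n + (1513302375)) * n + (494834202))

/-- Coefficient of `k ^ 8` in the certificate polynomial. -/
def cert8 (n : ℚ) : ℚ :=
  (((((((-93632) * n + (-987488)) * n + (-3908184)) * n + (-6974280)) * n + (-4750632)) * n + (792096)) * n + (1702908))

/-- Coefficient of `k ^ 9` in the certificate polynomial. -/
def cert9 (n : ℚ) : ℚ :=
  ((((((-2864) * n + (-40784)) * n + (-193872)) * n + (-404432)) * n + (-383264)) * n + (-136896))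

/-- Coefficient of `k ^ 10` in the certificate polynomial. -/
def cert10 (n : ℚ) : ℚ :=
  (((((256) * n + (1536)) * n + (2880)) * n + (1856)) * n + (384))

/-- The Zeilberger certificate polynomial. -/
def cert (n k : ℚ) : ℚ :=
  64 * (n + 4) * (2 * n + 1) ^ 2 * (((((((((((cert10 n) * k + cert9 n) * k + cert8 n) * k + cert7 n) * k + cert6 n) * k + cert5 n) * k + cert4 n) * k + cert3 n) * k + cert2 n) * k + cert1 n) * k + cert0 n)

/-- Summand of `A13`. -/
def term13 (n k : ℕ) : ℚ :=
  (((2 * n).choose n : ℚ)) ^ 2 * ((((2 * n + k).choose n : ℚ)) * ((n.choose k : ℚ)) ^ 2)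

/-- Common hypergeometric factor. -/
def base13 (n k : ℕ) : ℚ :=
  (((2 * n).choose n : ℚ)) ^ 2 * ((((2 * n + k).choose n : ℚ)) * (((n + 4).choose k : ℚ)) ^ 2) /
    ((((n : ℚ) + 1) * (n + 2) * (n + 3) * (n + 4)) ^ 3 *
      ((n + 1 + k) * (n + 2 + k) * (n + 3 + k) * (n + 4 + k)))

theorem A13_eq (n N : ℕ) (h : n < N) :
    A13 (n : ℤ) = ∑ k ∈ Finset.range N, term13 n k := by
  have h1 : A13 (n : ℤ) = ∑ k ∈ Finset.range (n + 1), term13 n k := by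
    unfold term13
    rw [← Finset.mul_sum]
    rfl
  rw [h1]
  apply Finset.sum_subset
  · intro x hx
    simp only [Finset.mem_range] at *
    omega
  · intro x _ hx
    simp only [Finset.mem_range] at hx
    unfold term13
    rw [Nat.choose_eq_zero_of_lt (show n < x by omega)]
    simp

theorem central_step (n : ℕ) :
    ((2 * (n + 1)).choose (n + 1) : ℚ) =
      ((2 * n).choose n : ℚ) * (2 * (2 * n + 1)) / (n + 1) := by
  have h := Nat.succ_mul_centralBinom_succ n
  simp only [Nat.centralBinom] at h
  have h2 : ((n : ℚ) + 1) * ((2 * (n + 1)).choose (n + 1) : ℚ) =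
      2 * (2 * n + 1) * ((2 * n).choose n : ℚ) := by exact_mod_cast h
  have h3 : ((n : ℚ) + 1) ≠ 0 := by positivity
  field_simp
  linarith

theorem choose_down (n k : ℕ) :
    (n.choose k : ℚ) = ((n + 1).choose k : ℚ) * (n + 1 - k) / (n + 1) := by
  have h3 : ((n : ℚ) + 1) ≠ 0 := by positivity
  rw [eq_div_iff h3]
  rcases le_or_gt k (n + 1) with hk | hk
  · have h := Nat.choose_mul_succ_eq n k
    have h2 : ((n.choose k * (n + 1) : ℕ) : ℚ) = (((n + 1).choose k * (n + 1 - k) : ℕ) : ℚ) := by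
      rw [h]
    push_cast [Nat.cast_sub hk] at h2
    exact h2
  · rw [Nat.choose_eq_zero_of_lt hk, Nat.choose_eq_zero_of_lt (show n < k by omega)]
    simp

theorem mid_eq (n k : ℕ) : ((2 * n + k).choose n : ℚ) =
    ((2 * n + k).factorial : ℚ) / (n.factorial * (n + k).factorial) := by
  rw [Nat.cast_choose ℚ (show n ≤ 2 * n + k by omega)]
  rw [show 2 * n + k - n = n + k by omega]

theorem mid_step (n k : ℕ) :
    ((2 * (n + 1) + k).choose (n + 1) : ℚ) =
      ((2 * n + k).choose n : ℚ) * ((2 * n + k + 1) * (2 * n + k + 2)) /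
        ((n + 1) * (n + 1 + k)) := by
  rw [mid_eq, mid_eq]
  rw [show 2 * (n + 1) + k = (2 * n + k + 1) + 1 by ring, show n + 1 + k = (n + k) + 1 by ring]
  rw [Nat.factorial_succ (2 * n + k + 1), Nat.factorial_succ (2 * n + k), Nat.factorial_succ n,
    Nat.factorial_succ (n + k)]
  have h1 : ((n.factorial : ℕ) : ℚ) ≠ 0 := by exact_mod_cast Nat.factorial_ne_zero n
  have h2 : (((n + k).factorial : ℕ) : ℚ) ≠ 0 := by exact_mod_cast Nat.factorial_ne_zero (n + k)
  have h3 : ((n : ℚ) + 1) ≠ 0 := by positivity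
  have h4 : ((n : ℚ) + k + 1) ≠ 0 := by positivity
  have h5 : ((n : ℚ) + 1 + k) ≠ 0 := by positivity
  push_cast
  field_simp
  ring

theorem mid_k (n k : ℕ) :
    ((2 * n + (k + 1)).choose n : ℚ) =
      ((2 * n + k).choose n : ℚ) * (2 * n + k + 1) / (n + 1 + k) := by
  rw [mid_eq, mid_eq]
  rw [show 2 * n + (k + 1) = (2 * n + k) + 1 by ring, show n + (k + 1) = (n + k) + 1 by ring]
  rw [Nat.factorial_succ (2 * n + k), Nat.factorial_succ (n + k)]
  have h1 : ((n.factorial : ℕ) : ℚ) ≠ 0 := by exact_mod_cast Nat.factorial_ne_zero n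
  have h2 : (((n + k).factorial : ℕ) : ℚ) ≠ 0 := by exact_mod_cast Nat.factorial_ne_zero (n + k)
  have h4 : ((n : ℚ) + k + 1) ≠ 0 := by positivity
  have h5 : ((n : ℚ) + 1 + k) ≠ 0 := by positivity
  push_cast
  field_simp
  ring

theorem choose_k (n k : ℕ) :
    (n.choose (k + 1) : ℚ) = (n.choose k : ℚ) * (n - k) / (k + 1) := by
  have h3 : ((k : ℚ) + 1) ≠ 0 := by positivity
  rw [eq_div_iff h3]
  rcases le_or_gt k n with hk | hk
  · have h := Nat.choose_succ_right_eq n k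
    have h2 : ((n.choose (k + 1) * (k + 1) : ℕ) : ℚ) = ((n.choose k * (n - k) : ℕ) : ℚ) := by
      rw [h]
    push_cast [Nat.cast_sub hk] at h2
    exact h2
  · rw [Nat.choose_eq_zero_of_lt hk, Nat.choose_eq_zero_of_lt (show n < k + 1 by omega)]
    simp

theorem base_k (n k : ℕ) :
    base13 n (k + 1) * ((n + 5 + k) * (k + 1) ^ 2) =
      base13 n k * ((2 * n + k + 1) * (n + 4 - k) ^ 2) := by
  unfold base13
  rw [mid_k, choose_k]
  push_cast
  have h1 : ((k : ℚ) + 1) ≠ 0 := by positivity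
  have h2 : ((n : ℚ) + 1 + k) ≠ 0 := by positivity
  rw [show (n : ℚ) + 1 + (k + 1) = n + 2 + k by ring, show (n : ℚ) + 2 + (k + 1) = n + 3 + k by ring,
    show (n : ℚ) + 3 + (k + 1) = n + 4 + k by ring, show (n : ℚ) + 4 + (k + 1) = n + 5 + k by ring]
  have h3 : ((n : ℚ) + 2 + k) ≠ 0 := by positivity
  have h4 : ((n : ℚ) + 3 + k) ≠ 0 := by positivity
  have h5 : ((n : ℚ) + 4 + k) ≠ 0 := by positivity
  have h6 : ((n : ℚ) + 5 + k) ≠ 0 := by positivity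
  have h7 : ((n : ℚ) + 1) ≠ 0 := by positivity
  have h8 : ((n : ℚ) + 2) ≠ 0 := by positivity
  have h9 : ((n : ℚ) + 3) ≠ 0 := by positivity
  have h10 : ((n : ℚ) + 4) ≠ 0 := by positivity
  field_simp

/-- Ratio of the shifted summand to the common factor. -/
def pol0 (n k : ℚ) : ℚ :=
  1 * (n + 1) * (n + 2) * (n + 3) * (n + 4) * (n + 1 + k) * (n + 2 + k) * (n + 3 + k) * (n + 4 + k) * (n + 1 - k) ^ 2 * (n + 2 - k) ^ 2 * (n + 3 - k) ^ 2 * (n + 4 - k) ^ 2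

/-- Ratio of the shifted summand to the common factor. -/
def pol1 (n k : ℚ) : ℚ :=
  4 * (2 * n + 1) ^ 2 * (2 * n + k + 1) * (2 * n + k + 2) * (n + 2) * (n + 3) * (n + 4) * (n + 2 + k) * (n + 3 + k) * (n + 4 + k) * (n + 2 - k) ^ 2 * (n + 3 - k) ^ 2 * (n + 4 - k) ^ 2

/-- Ratio of the shifted summand to the common factor. -/
def pol2 (n k : ℚ) : ℚ :=
  16 * (2 * n + 1) ^ 2 * (2 * n + 3) ^ 2 * (2 * n + k + 1) * (2 * n + k + 2) * (2 * n + k + 3) * (2 * n + k + 4) * (n + 3) * (n + 4) * (n + 3 + k) * (n + 4 + k) * (n + 3 - k) ^ 2 * (n + 4 - k) ^ 2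

/-- Ratio of the shifted summand to the common factor. -/
def pol3 (n k : ℚ) : ℚ :=
  64 * (2 * n + 1) ^ 2 * (2 * n + 3) ^ 2 * (2 * n + 5) ^ 2 * (2 * n + k + 1) * (2 * n + k + 2) * (2 * n + k + 3) * (2 * n + k + 4) * (2 * n + k + 5) * (2 * n + k + 6) * (n + 4) * (n + 4 + k) * (n + 4 - k) ^ 2

/-- Ratio of the shifted summand to the common factor. -/
def pol4 (n k : ℚ) : ℚ :=
  256 * (2 * n + 1) ^ 2 * (2 * n + 3) ^ 2 * (2 * n + 5) ^ 2 * (2 * n + 7) ^ 2 * (2 * n + k + 1) * (2 * n + k + 2) * (2 * n + k + 3) * (2 * n + k + 4) * (2 * n + k + 5) * (2 * n + k + 6) * (2 * n + k + 7) * (2 * n + k + 8)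

theorem central_stepx (n : ℕ) (x y : ℚ) (hx : x = n + 1) (hy : y = 2 * n + 1) :
    ((2 * (n + 1)).choose (n + 1) : ℚ) = ((2 * n).choose n : ℚ) * (2 * y) / x := by
  rw [hx, hy, central_step]

theorem choose_downx (n k : ℕ) (x y : ℚ) (hx : x = n + 1) (hy : y = n + 1 - k) :
    (n.choose k : ℚ) = ((n + 1).choose k : ℚ) * y / x := by
  rw [hx, hy, choose_down]

theorem mid_stepx (n k : ℕ) (x y z w : ℚ) (hx : x = n + 1) (hy : y = n + 1 + k)
    (hz : z = 2 * n + k + 1) (hw : w = 2 * n + k + 2) :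
    ((2 * (n + 1) + k).choose (n + 1) : ℚ) =
      ((2 * n + k).choose n : ℚ) * (z * w) / (x * y) := by
  rw [hx, hy, hz, hw, mid_step]

theorem algG (D T E a b c p q r s : ℚ) (hp : p ≠ 0) (hq : q ≠ 0) (hr : r ≠ 0) (hs : s ≠ 0) :
    (D * a / p) ^ 2 * (T * b / (p * q) * (E * c / r) ^ 2) =
      D ^ 2 * (T * E ^ 2) / ((p * r) ^ 3 * (q * s)) * (a ^ 2 * b * r * s * c ^ 2) := by
  field_simp

theorem alg0 (D T E x1 x2 x3 x4 u1 u2 u3 u4 v1 v2 v3 v4   : ℚ)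
    (h1 : x1 ≠ 0) (h2 : x2 ≠ 0) (h3 : x3 ≠ 0) (h4 : x4 ≠ 0)
    (g1 : u1 ≠ 0) (g2 : u2 ≠ 0) (g3 : u3 ≠ 0) (g4 : u4 ≠ 0) :
    D ^ 2 * (T * ((((E * v4 / x4) * v3 / x3) * v2 / x2) * v1 / x1) ^ 2) =
      D ^ 2 * (T * E ^ 2) / ((x1 * x2 * x3 * x4) ^ 3 * (u1 * u2 * u3 * u4)) *
        (1 * x1 * x2 * x3 * x4 * u1 * u2 * u3 * u4 * v1 ^ 2 * v2 ^ 2 * v3 ^ 2 * v4 ^ 2) := by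
  have hD : D = D * (1) / (1) := by ring
  have hT : T = T * (1) / ((1) * (1)) := by ring
  have hE : ((((E * v4 / x4) * v3 / x3) * v2 / x2) * v1 / x1) = E * (v1 * v2 * v3 * v4) / (x1 * x2 * x3 * x4) := by ring
  have hG := algG D T E (1) (1) (v1 * v2 * v3 * v4) (1) (1) (x1 * x2 * x3 * x4) (u1 * u2 * u3 * u4)
    one_ne_zero one_ne_zero (mul_ne_zero (mul_ne_zero (mul_ne_zero h1 h2) h3) h4) (mul_ne_zero (mul_ne_zero (mul_ne_zero g1 g2) g3) g4)
  rw [← hD, ← hT, ← hE] at hG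
  rw [hG]
  refine congrArg₂ (fun s t => D ^ 2 * (T * E ^ 2) / s * t) ?_ ?_ <;> ring

theorem term_eq0 (n k : ℕ) : term13 n k = base13 n k * pol0 n k := by
  have e0 := choose_downx n k (n + 1) (n + 1 - k) (by push_cast; ring) (by push_cast; ring)
  have e1 := choose_downx (n + 1) k (n + 2) (n + 2 - k) (by push_cast; ring) (by push_cast; ring)
  have e2 := choose_downx (n + 2) k (n + 3) (n + 3 - k) (by push_cast; ring) (by push_cast; ring)
  have e3 := choose_downx (n + 3) k (n + 4) (n + 4 - k) (by push_cast; ring) (by push_cast; ring)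
  simp only [add_assoc n, Nat.reduceAdd] at e0 e1 e2 e3
  have h1 : (n : ℚ) + 1 ≠ 0 := by positivity
  have g1 : (n : ℚ) + 1 + k ≠ 0 := by positivity
  have h2 : (n : ℚ) + 2 ≠ 0 := by positivity
  have g2 : (n : ℚ) + 2 + k ≠ 0 := by positivity
  have h3 : (n : ℚ) + 3 ≠ 0 := by positivity
  have g3 : (n : ℚ) + 3 + k ≠ 0 := by positivity
  have h4 : (n : ℚ) + 4 ≠ 0 := by positivity
  have g4 : (n : ℚ) + 4 + k ≠ 0 := by positivity
  unfold term13 base13 pol0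
  rw [e0, e1, e2, e3]
  exact alg0 _ _ _ _ _ _ _ _ _ _ _ _ _ _ _ h1 h2 h3 h4 g1 g2 g3 g4

theorem alg1 (D T E x1 x2 x3 x4 u1 u2 u3 u4 v2 v3 v4 y1 z1 z2 : ℚ)
    (h1 : x1 ≠ 0) (h2 : x2 ≠ 0) (h3 : x3 ≠ 0) (h4 : x4 ≠ 0)
    (g1 : u1 ≠ 0) (g2 : u2 ≠ 0) (g3 : u3 ≠ 0) (g4 : u4 ≠ 0) :
    (D * (2 * y1) / x1) ^ 2 * ((T * (z1 * z2) / (x1 * u1)) * (((E * v4 / x4) * v3 / x3) * v2 / x2) ^ 2) =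
      D ^ 2 * (T * E ^ 2) / ((x1 * x2 * x3 * x4) ^ 3 * (u1 * u2 * u3 * u4)) *
        (4 * y1 ^ 2 * z1 * z2 * x2 * x3 * x4 * u2 * u3 * u4 * v2 ^ 2 * v3 ^ 2 * v4 ^ 2) := by
  have hD : (D * (2 * y1) / x1) = D * (2 * y1) / (x1) := by ring
  have hT : (T * (z1 * z2) / (x1 * u1)) = T * (z1 * z2) / ((x1) * (u1)) := by ring
  have hE : (((E * v4 / x4) * v3 / x3) * v2 / x2) = E * (v2 * v3 * v4) / (x2 * x3 * x4) := by ring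
  have hG := algG D T E (2 * y1) (z1 * z2) (v2 * v3 * v4) (x1) (u1) (x2 * x3 * x4) (u2 * u3 * u4)
    h1 g1 (mul_ne_zero (mul_ne_zero h2 h3) h4) (mul_ne_zero (mul_ne_zero g2 g3) g4)
  rw [← hD, ← hT, ← hE] at hG
  rw [hG]
  refine congrArg₂ (fun s t => D ^ 2 * (T * E ^ 2) / s * t) ?_ ?_ <;> ring

theorem term_eq1 (n k : ℕ) : term13 (n + 1) k = base13 n k * pol1 n k := by
  have d1 := central_stepx n (n + 1) (2 * n + 1) (by push_cast; ring) (by push_cast; ring)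
  have m1 := mid_stepx n k (n + 1) (n + 1 + k) (2 * n + k + 1)
    (2 * n + k + 2) (by push_cast; ring) (by push_cast; ring) (by push_cast; ring) (by push_cast; ring)
  have e1 := choose_downx (n + 1) k (n + 2) (n + 2 - k) (by push_cast; ring) (by push_cast; ring)
  have e2 := choose_downx (n + 2) k (n + 3) (n + 3 - k) (by push_cast; ring) (by push_cast; ring)
  have e3 := choose_downx (n + 3) k (n + 4) (n + 4 - k) (by push_cast; ring) (by push_cast; ring)
  simp only [add_assoc n, Nat.reduceAdd] at d1 m1 e1 e2 e3
  have h1 : (n : ℚ) + 1 ≠ 0 := by positivity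
  have g1 : (n : ℚ) + 1 + k ≠ 0 := by positivity
  have h2 : (n : ℚ) + 2 ≠ 0 := by positivity
  have g2 : (n : ℚ) + 2 + k ≠ 0 := by positivity
  have h3 : (n : ℚ) + 3 ≠ 0 := by positivity
  have g3 : (n : ℚ) + 3 + k ≠ 0 := by positivity
  have h4 : (n : ℚ) + 4 ≠ 0 := by positivity
  have g4 : (n : ℚ) + 4 + k ≠ 0 := by positivity
  unfold term13 base13 pol1
  rw [d1, m1, e1, e2, e3]
  exact alg1 _ _ _ _ _ _ _ _ _ _ _ _ _ _ _ _ _ h1 h2 h3 h4 g1 g2 g3 g4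

theorem alg2 (D T E x1 x2 x3 x4 u1 u2 u3 u4 v3 v4 y1 y2 z1 z2 z3 z4 : ℚ)
    (h1 : x1 ≠ 0) (h2 : x2 ≠ 0) (h3 : x3 ≠ 0) (h4 : x4 ≠ 0)
    (g1 : u1 ≠ 0) (g2 : u2 ≠ 0) (g3 : u3 ≠ 0) (g4 : u4 ≠ 0) :
    ((D * (2 * y1) / x1) * (2 * y2) / x2) ^ 2 * (((T * (z1 * z2) / (x1 * u1)) * (z3 * z4) / (x2 * u2)) * ((E * v4 / x4) * v3 / x3) ^ 2) =
      D ^ 2 * (T * E ^ 2) / ((x1 * x2 * x3 * x4) ^ 3 * (u1 * u2 * u3 * u4)) *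
        (16 * y1 ^ 2 * y2 ^ 2 * z1 * z2 * z3 * z4 * x3 * x4 * u3 * u4 * v3 ^ 2 * v4 ^ 2) := by
  have hD : ((D * (2 * y1) / x1) * (2 * y2) / x2) = D * (4 * y1 * y2) / (x1 * x2) := by ring
  have hT : ((T * (z1 * z2) / (x1 * u1)) * (z3 * z4) / (x2 * u2)) = T * (z1 * z2 * z3 * z4) / ((x1 * x2) * (u1 * u2)) := by ring
  have hE : ((E * v4 / x4) * v3 / x3) = E * (v3 * v4) / (x3 * x4) := by ring
  have hG := algG D T E (4 * y1 * y2) (z1 * z2 * z3 * z4) (v3 * v4) (x1 * x2) (u1 * u2) (x3 * x4) (u3 * u4)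
    (mul_ne_zero h1 h2) (mul_ne_zero g1 g2) (mul_ne_zero h3 h4) (mul_ne_zero g3 g4)
  rw [← hD, ← hT, ← hE] at hG
  rw [hG]
  refine congrArg₂ (fun s t => D ^ 2 * (T * E ^ 2) / s * t) ?_ ?_ <;> ring

theorem term_eq2 (n k : ℕ) : term13 (n + 2) k = base13 n k * pol2 n k := by
  have d1 := central_stepx n (n + 1) (2 * n + 1) (by push_cast; ring) (by push_cast; ring)
  have m1 := mid_stepx n k (n + 1) (n + 1 + k) (2 * n + k + 1)
    (2 * n + k + 2) (by push_cast; ring) (by push_cast; ring) (by push_cast; ring) (by push_cast; ring)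
  have d2 := central_stepx (n + 1) (n + 2) (2 * n + 3) (by push_cast; ring) (by push_cast; ring)
  have m2 := mid_stepx (n + 1) k (n + 2) (n + 2 + k) (2 * n + k + 3)
    (2 * n + k + 4) (by push_cast; ring) (by push_cast; ring) (by push_cast; ring) (by push_cast; ring)
  have e2 := choose_downx (n + 2) k (n + 3) (n + 3 - k) (by push_cast; ring) (by push_cast; ring)
  have e3 := choose_downx (n + 3) k (n + 4) (n + 4 - k) (by push_cast; ring) (by push_cast; ring)
  simp only [add_assoc n, Nat.reduceAdd] at d1 d2 m1 m2 e2 e3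
  have h1 : (n : ℚ) + 1 ≠ 0 := by positivity
  have g1 : (n : ℚ) + 1 + k ≠ 0 := by positivity
  have h2 : (n : ℚ) + 2 ≠ 0 := by positivity
  have g2 : (n : ℚ) + 2 + k ≠ 0 := by positivity
  have h3 : (n : ℚ) + 3 ≠ 0 := by positivity
  have g3 : (n : ℚ) + 3 + k ≠ 0 := by positivity
  have h4 : (n : ℚ) + 4 ≠ 0 := by positivity
  have g4 : (n : ℚ) + 4 + k ≠ 0 := by positivity
  unfold term13 base13 pol2
  rw [d2, d1, m2, m1, e2, e3]
  exact alg2 _ _ _ _ _ _ _ _ _ _ _ _ _ _ _ _ _ _ _ h1 h2 h3 h4 g1 g2 g3 g4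

theorem alg3 (D T E x1 x2 x3 x4 u1 u2 u3 u4 v4 y1 y2 y3 z1 z2 z3 z4 z5 z6 : ℚ)
    (h1 : x1 ≠ 0) (h2 : x2 ≠ 0) (h3 : x3 ≠ 0) (h4 : x4 ≠ 0)
    (g1 : u1 ≠ 0) (g2 : u2 ≠ 0) (g3 : u3 ≠ 0) (g4 : u4 ≠ 0) :
    (((D * (2 * y1) / x1) * (2 * y2) / x2) * (2 * y3) / x3) ^ 2 * ((((T * (z1 * z2) / (x1 * u1)) * (z3 * z4) / (x2 * u2)) * (z5 * z6) / (x3 * u3)) * (E * v4 / x4) ^ 2) =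
      D ^ 2 * (T * E ^ 2) / ((x1 * x2 * x3 * x4) ^ 3 * (u1 * u2 * u3 * u4)) *
        (64 * y1 ^ 2 * y2 ^ 2 * y3 ^ 2 * z1 * z2 * z3 * z4 * z5 * z6 * x4 * u4 * v4 ^ 2) := by
  have hD : (((D * (2 * y1) / x1) * (2 * y2) / x2) * (2 * y3) / x3) = D * (8 * y1 * y2 * y3) / (x1 * x2 * x3) := by ring
  have hT : (((T * (z1 * z2) / (x1 * u1)) * (z3 * z4) / (x2 * u2)) * (z5 * z6) / (x3 * u3)) = T * (z1 * z2 * z3 * z4 * z5 * z6) / ((x1 * x2 * x3) * (u1 * u2 * u3)) := by ring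
  have hE : (E * v4 / x4) = E * (v4) / (x4) := by ring
  have hG := algG D T E (8 * y1 * y2 * y3) (z1 * z2 * z3 * z4 * z5 * z6) (v4) (x1 * x2 * x3) (u1 * u2 * u3) (x4) (u4)
    (mul_ne_zero (mul_ne_zero h1 h2) h3) (mul_ne_zero (mul_ne_zero g1 g2) g3) h4 g4
  rw [← hD, ← hT, ← hE] at hG
  rw [hG]
  refine congrArg₂ (fun s t => D ^ 2 * (T * E ^ 2) / s * t) ?_ ?_ <;> ring

theorem term_eq3 (n k : ℕ) : term13 (n + 3) k = base13 n k * pol3 n k := by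
  have d1 := central_stepx n (n + 1) (2 * n + 1) (by push_cast; ring) (by push_cast; ring)
  have m1 := mid_stepx n k (n + 1) (n + 1 + k) (2 * n + k + 1)
    (2 * n + k + 2) (by push_cast; ring) (by push_cast; ring) (by push_cast; ring) (by push_cast; ring)
  have d2 := central_stepx (n + 1) (n + 2) (2 * n + 3) (by push_cast; ring) (by push_cast; ring)
  have m2 := mid_stepx (n + 1) k (n + 2) (n + 2 + k) (2 * n + k + 3)
    (2 * n + k + 4) (by push_cast; ring) (by push_cast; ring) (by push_cast; ring) (by push_cast; ring)
  have d3 := central_stepx (n + 2) (n + 3) (2 * n + 5) (by push_cast; ring) (by push_cast; ring)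
  have m3 := mid_stepx (n + 2) k (n + 3) (n + 3 + k) (2 * n + k + 5)
    (2 * n + k + 6) (by push_cast; ring) (by push_cast; ring) (by push_cast; ring) (by push_cast; ring)
  have e3 := choose_downx (n + 3) k (n + 4) (n + 4 - k) (by push_cast; ring) (by push_cast; ring)
  simp only [add_assoc n, Nat.reduceAdd] at d1 d2 d3 m1 m2 m3 e3
  have h1 : (n : ℚ) + 1 ≠ 0 := by positivity
  have g1 : (n : ℚ) + 1 + k ≠ 0 := by positivity
  have h2 : (n : ℚ) + 2 ≠ 0 := by positivity
  have g2 : (n : ℚ) + 2 + k ≠ 0 := by positivity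
  have h3 : (n : ℚ) + 3 ≠ 0 := by positivity
  have g3 : (n : ℚ) + 3 + k ≠ 0 := by positivity
  have h4 : (n : ℚ) + 4 ≠ 0 := by positivity
  have g4 : (n : ℚ) + 4 + k ≠ 0 := by positivity
  unfold term13 base13 pol3
  rw [d3, d2, d1, m3, m2, m1, e3]
  exact alg3 _ _ _ _ _ _ _ _ _ _ _ _ _ _ _ _ _ _ _ _ _ h1 h2 h3 h4 g1 g2 g3 g4

theorem alg4 (D T E x1 x2 x3 x4 u1 u2 u3 u4  y1 y2 y3 y4 z1 z2 z3 z4 z5 z6 z7 z8 : ℚ)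
    (h1 : x1 ≠ 0) (h2 : x2 ≠ 0) (h3 : x3 ≠ 0) (h4 : x4 ≠ 0)
    (g1 : u1 ≠ 0) (g2 : u2 ≠ 0) (g3 : u3 ≠ 0) (g4 : u4 ≠ 0) :
    ((((D * (2 * y1) / x1) * (2 * y2) / x2) * (2 * y3) / x3) * (2 * y4) / x4) ^ 2 * (((((T * (z1 * z2) / (x1 * u1)) * (z3 * z4) / (x2 * u2)) * (z5 * z6) / (x3 * u3)) * (z7 * z8) / (x4 * u4)) * E ^ 2) =
      D ^ 2 * (T * E ^ 2) / ((x1 * x2 * x3 * x4) ^ 3 * (u1 * u2 * u3 * u4)) *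
        (256 * y1 ^ 2 * y2 ^ 2 * y3 ^ 2 * y4 ^ 2 * z1 * z2 * z3 * z4 * z5 * z6 * z7 * z8) := by
  have hD : ((((D * (2 * y1) / x1) * (2 * y2) / x2) * (2 * y3) / x3) * (2 * y4) / x4) = D * (16 * y1 * y2 * y3 * y4) / (x1 * x2 * x3 * x4) := by ring
  have hT : ((((T * (z1 * z2) / (x1 * u1)) * (z3 * z4) / (x2 * u2)) * (z5 * z6) / (x3 * u3)) * (z7 * z8) / (x4 * u4)) = T * (z1 * z2 * z3 * z4 * z5 * z6 * z7 * z8) / ((x1 * x2 * x3 * x4) * (u1 * u2 * u3 * u4)) := by ring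
  have hE : E = E * (1) / (1) := by ring
  have hG := algG D T E (16 * y1 * y2 * y3 * y4) (z1 * z2 * z3 * z4 * z5 * z6 * z7 * z8) (1) (x1 * x2 * x3 * x4) (u1 * u2 * u3 * u4) (1) (1)
    (mul_ne_zero (mul_ne_zero (mul_ne_zero h1 h2) h3) h4) (mul_ne_zero (mul_ne_zero (mul_ne_zero g1 g2) g3) g4) one_ne_zero one_ne_zero
  rw [← hD, ← hT, ← hE] at hG
  rw [hG]
  refine congrArg₂ (fun s t => D ^ 2 * (T * E ^ 2) / s * t) ?_ ?_ <;> ring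

theorem term_eq4 (n k : ℕ) : term13 (n + 4) k = base13 n k * pol4 n k := by
  have d1 := central_stepx n (n + 1) (2 * n + 1) (by push_cast; ring) (by push_cast; ring)
  have m1 := mid_stepx n k (n + 1) (n + 1 + k) (2 * n + k + 1)
    (2 * n + k + 2) (by push_cast; ring) (by push_cast; ring) (by push_cast; ring) (by push_cast; ring)
  have d2 := central_stepx (n + 1) (n + 2) (2 * n + 3) (by push_cast; ring) (by push_cast; ring)
  have m2 := mid_stepx (n + 1) k (n + 2) (n + 2 + k) (2 * n + k + 3)
    (2 * n + k + 4) (by push_cast; ring) (by push_cast; ring) (by push_cast; ring) (by push_cast; ring)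
  have d3 := central_stepx (n + 2) (n + 3) (2 * n + 5) (by push_cast; ring) (by push_cast; ring)
  have m3 := mid_stepx (n + 2) k (n + 3) (n + 3 + k) (2 * n + k + 5)
    (2 * n + k + 6) (by push_cast; ring) (by push_cast; ring) (by push_cast; ring) (by push_cast; ring)
  have d4 := central_stepx (n + 3) (n + 4) (2 * n + 7) (by push_cast; ring) (by push_cast; ring)
  have m4 := mid_stepx (n + 3) k (n + 4) (n + 4 + k) (2 * n + k + 7)
    (2 * n + k + 8) (by push_cast; ring) (by push_cast; ring) (by push_cast; ring) (by push_cast; ring)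
  simp only [add_assoc n, Nat.reduceAdd] at d1 d2 d3 d4 m1 m2 m3 m4
  have h1 : (n : ℚ) + 1 ≠ 0 := by positivity
  have g1 : (n : ℚ) + 1 + k ≠ 0 := by positivity
  have h2 : (n : ℚ) + 2 ≠ 0 := by positivity
  have g2 : (n : ℚ) + 2 + k ≠ 0 := by positivity
  have h3 : (n : ℚ) + 3 ≠ 0 := by positivity
  have g3 : (n : ℚ) + 3 + k ≠ 0 := by positivity
  have h4 : (n : ℚ) + 4 ≠ 0 := by positivity
  have g4 : (n : ℚ) + 4 + k ≠ 0 := by positivity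
  unfold term13 base13 pol4
  rw [d4, d3, d2, d1, m4, m3, m2, m1]
  exact alg4 _ _ _ _ _ _ _ _ _ _ _ _ _ _ _ _ _ _ _ _ _ _ _ h1 h2 h3 h4 g1 g2 g3 g4

set_option maxHeartbeats 4000000 in
theorem cert_identity (n k : ℚ) :
    169 * (n + 4) ^ 4 * pol4 n k -
      (59397 * (n + 3) ^ 4 + 117546 * (n + 3) ^ 3 + 86827 * (n + 3) ^ 2 + 28054 * (n + 3) + 3380) *
        pol3 n k +
      16 * (6386 * (n + 2) ^ 4 - 1774 * (n + 2) ^ 3 - 17898 * (n + 2) ^ 2 - 11596 * (n + 2) - 2119) *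
        pol2 n k +
      256 * (67 * (n + 1) ^ 4 + 1248 * (n + 1) ^ 3 + 1091 * (n + 1) ^ 2 + 312 * (n + 1) + 26) *
        pol1 n k -
      4096 * (2 * n + 1) ^ 4 * pol0 n k =
    (2 * n + k + 1) * (n + 4 - k) ^ 2 * cert n (k + 1) - (n + 4 + k) * k ^ 2 * cert n k := by
  unfold pol0 pol1 pol2 pol3 pol4 cert cert0 cert1 cert2 cert3 cert4 cert5 cert6 cert7 cert8 cert9
    cert10
  ring

theorem sum_zero (n : ℕ) :
    ∑ k ∈ Finset.range (n + 5),
      base13 n k * ((2 * n + k + 1) * (n + 4 - k) ^ 2 * cert n (k + 1) -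
        (n + 4 + k) * k ^ 2 * cert n k) = 0 := by
  have h : ∀ N : ℕ, ∑ k ∈ Finset.range N,
      base13 n k * ((2 * n + k + 1) * (n + 4 - k) ^ 2 * cert n (k + 1) -
        (n + 4 + k) * k ^ 2 * cert n k) =
      base13 n N * ((n + 4 + N) * (N : ℚ) ^ 2) * cert n N := by
    intro N
    induction N with
    | zero => simp
    | succ N ih =>
      rw [Finset.sum_range_succ, ih]
      have hb := base_k n N
      push_cast
      linear_combination (-cert n (N + 1)) * hb
  rw [h]
  unfold base13
  rw [Nat.choose_eq_zero_of_lt (show n + 4 < n + 5 by omega)]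
  simp

theorem rec_nat (m : ℕ) :
    169 * ((m : ℚ) + 4) ^ 4 * A13 ((m + 4 : ℕ) : ℤ) -
      (59397 * ((m : ℚ) + 3) ^ 4 + 117546 * ((m : ℚ) + 3) ^ 3 + 86827 * ((m : ℚ) + 3) ^ 2 +
        28054 * ((m : ℚ) + 3) + 3380) * A13 ((m + 3 : ℕ) : ℤ) +
      16 * (6386 * ((m : ℚ) + 2) ^ 4 - 1774 * ((m : ℚ) + 2) ^ 3 - 17898 * ((m : ℚ) + 2) ^ 2 -
        11596 * ((m : ℚ) + 2) - 2119) * A13 ((m + 2 : ℕ) : ℤ) +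
      256 * (67 * ((m : ℚ) + 1) ^ 4 + 1248 * ((m : ℚ) + 1) ^ 3 + 1091 * ((m : ℚ) + 1) ^ 2 +
        312 * ((m : ℚ) + 1) + 26) * A13 ((m + 1 : ℕ) : ℤ) -
      4096 * (2 * (m : ℚ) + 1) ^ 4 * A13 ((m : ℕ) : ℤ) = 0 := by
  rw [A13_eq (m + 4) (m + 5) (by omega), A13_eq (m + 3) (m + 5) (by omega),
    A13_eq (m + 2) (m + 5) (by omega), A13_eq (m + 1) (m + 5) (by omega),
    A13_eq m (m + 5) (by omega)]
  rw [← sum_zero m]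
  simp only [Finset.mul_sum]
  rw [← Finset.sum_sub_distrib, ← Finset.sum_add_distrib, ← Finset.sum_add_distrib,
    ← Finset.sum_sub_distrib]
  apply Finset.sum_congr rfl
  intro k _
  rw [← cert_identity, term_eq4, term_eq3, term_eq2, term_eq1, term_eq0]
  ring

theorem A13_neg (m : ℕ) : A13 (Int.negSucc m) = 0 := rfl

theorem A13_zero : A13 0 = 1 := by
  rw [show (0 : ℤ) = ((0 : ℕ) : ℤ) by rfl, A13_eq 0 1 (by omega)]
  simp [term13]

theorem A13_one : A13 1 = 20 := by
  rw [show (1 : ℤ) = ((1 : ℕ) : ℤ) by rfl, A13_eq 1 2 (by omega)]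
  norm_num [term13, Finset.sum_range_succ, Nat.choose]

theorem A13_two : A13 2 = 2196 := by
  rw [show (2 : ℤ) = ((2 : ℕ) : ℤ) by rfl, A13_eq 2 3 (by omega)]
  norm_num [term13, Finset.sum_range_succ, Nat.choose]

theorem A13_three : A13 3 = 369200 := by
  rw [show (3 : ℤ) = ((3 : ℕ) : ℤ) by rfl, A13_eq 3 4 (by omega)]
  norm_num [term13, Finset.sum_range_succ, Nat.choose]

/-- The coefficients of the fundamental period of the degree 13 pfaffian mirror family
satisfy the recurrence coming from the Picard–Fuchs operator
`13²Θ⁴ − φ·q₁(Θ) + 2⁴φ²·q₂(Θ) + 2⁸φ³·q₃(Θ) − 2¹²φ⁴(2Θ+1)⁴`. -/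
theorem A13_recurrence (n : ℤ) (hn : 1 ≤ n) :
    169 * (n : ℚ) ^ 4 * A13 n =
      (59397 * ((n : ℚ) - 1) ^ 4 + 117546 * ((n : ℚ) - 1) ^ 3 +
          86827 * ((n : ℚ) - 1) ^ 2 + 28054 * ((n : ℚ) - 1) + 3380) * A13 (n - 1)
        - 16 * (6386 * ((n : ℚ) - 2) ^ 4 - 1774 * ((n : ℚ) - 2) ^ 3 -
            17898 * ((n : ℚ) - 2) ^ 2 - 11596 * ((n : ℚ) - 2) - 2119) * A13 (n - 2)
        - 256 * (67 * ((n : ℚ) - 3) ^ 4 + 1248 * ((n : ℚ) - 3) ^ 3 +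
            1091 * ((n : ℚ) - 3) ^ 2 + 312 * ((n : ℚ) - 3) + 26) * A13 (n - 3)
        + 4096 * (2 * (n : ℚ) - 7) ^ 4 * A13 (n - 4) := by
  have n1 : A13 (-1) = 0 := A13_neg 0
  have n2 : A13 (-2) = 0 := A13_neg 1
  have n3 : A13 (-3) = 0 := A13_neg 2
  rcases lt_or_ge n 4 with h4 | h4
  · interval_cases n
    · norm_num [n1, n2, n3, A13_zero, A13_one]
    · norm_num [n1, n2, n3, A13_zero, A13_one, A13_two]
    · norm_num [n1, n2, n3, A13_zero, A13_one, A13_two, A13_three]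
  · obtain ⟨m, rfl⟩ : ∃ m : ℕ, n = (m : ℤ) + 4 := ⟨(n - 4).toNat, by omega⟩
    have h := rec_nat m
    rw [show (m : ℤ) + 4 - 1 = ((m + 3 : ℕ) : ℤ) by push_cast; ring,
      show (m : ℤ) + 4 - 2 = ((m + 2 : ℕ) : ℤ) by push_cast; ring,
      show (m : ℤ) + 4 - 3 = ((m + 1 : ℕ) : ℤ) by push_cast; ring,
      show (m : ℤ) + 4 - 4 = ((m : ℕ) : ℤ) by ring,
      show ((m : ℤ) + 4) = ((m + 4 : ℕ) : ℤ) by push_cast; ring]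
    generalize A13 ((m + 4 : ℕ) : ℤ) = a4 at *
    generalize A13 ((m + 3 : ℕ) : ℤ) = a3 at *
    generalize A13 ((m + 2 : ℕ) : ℤ) = a2 at *
    generalize A13 ((m + 1 : ℕ) : ℤ) = a1 at *
    generalize A13 ((m : ℕ) : ℤ) = a0 at *
    push_cast
    linear_combination h
end

section
/- Define A : ℕ → ℚ by A_n = C(2n, n) · ∑_{k=0}^{2n} (−1)^{k+n}·C(2n, k)⁴, and extend A by A_m = 0 for m < 0. Then for every integer n ≥ 1, 25·n⁴·A_n = 20·q₁(n−1)·A_{n−1} − 16·q₂(n−2)·A_{n−2} + 1024·q₃(n−3)·A_{n−3} − 4096·(2n−7)⁴·A_{n−4}, where q₁(m) = 688m⁴ + 1352m³ + 981m² + 305m + 35, q₂(m) = 5856m⁴ + 7008m³ + 96m² − 1260m − 265, and q₃(m) = 176m⁴ + 120m³ + 69m² + 30m + 5. Equivalently, the formal power series ∑_{n≥0} A_n φⁿ is annihilated by the Picard–Fuchs operator 5²Θ⁴ − 2²·5·φ·q₁(Θ) + 2⁴φ²·q₂(Θ) − 2¹⁰φ³·q₃(Θ) + 2¹²φ⁴(2Θ+1)⁴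 with Θ = φ·d/dφ. -/
/-- The coefficients `A_n = C(2n,n)·∑_{k=0}^{2n} (−1)^{k+n}·C(2n,k)⁴` of the fundamental
period of the mirror family of the degree 10 pfaffian Calabi–Yau threefold, extended by
`0` to negative indices. -/
def A10 : ℤ → ℚ
  | Int.ofNat n =>
      (((2 * n).choose n : ℚ)) *
        ∑ k ∈ Finset.range (2 * n + 1), (-1 : ℚ) ^ (k + n) * (((2 * n).choose k : ℚ)) ^ 4
  | Int.negSucc _ => 0

/-- The alternating sum of fourth powers of binomial coefficients. -/
def S10 (n : ℕ) : ℚ :=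
  ∑ k ∈ Finset.range (2 * n + 1), (-1 : ℚ) ^ (k + n) * (((2 * n).choose k : ℚ)) ^ 4

/-- The polynomial part of the Zeilberger certificate. -/
def X10 (N i : ℚ) : ℚ :=
  ((-15936) * N ^ 3 + (227949) * N ^ 4 + (-1446230) * N ^ 5 + (5374788) * N ^ 6 + (-13022200) * N ^ 7 + (21637454) * N ^ 8 + (-25202852) * N ^ 9 + (20609020) * N ^ 10 + (-11608848) * N ^ 11 + (4294325) * N ^ 12 + (-939678) * N ^ 13 + (92208) * N ^ 14) * (i * (i - 1)) ^ 0 +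
  ((-28884) * N ^ 2 + (382456) * N ^ 3 + (-2206035) * N ^ 4 + (7296822) * N ^ 5 + (-15363444) * N ^ 6 + (21579644) * N ^ 7 + (-20536551) * N ^ 8 + (13107530) * N ^ 9 + (-5380982) * N ^ 10 + (1285284) * N ^ 11 + (-135840) * N ^ 12) * (i * (i - 1)) ^ 1 +
  ((-19920) * N ^ 1 + (247154) * N ^ 2 + (-1309416) * N ^ 3 + (3879023) * N ^ 4 + (-7103078) * N ^ 5 + (8373660) * N ^ 6 + (-6381464) * N ^ 7 + (3042411) * N ^ 8 + (-825858) * N ^ 9 + (97488) * N ^ 10) * (i * (i - 1)) ^ 2 +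
  ((-4980) + (59320) * N ^ 1 + (-295498) * N ^ 2 + (798824) * N ^ 3 + (-1284530) * N ^ 4 + (1264620) * N ^ 5 + (-748500) * N ^ 6 + (244728) * N ^ 7 + (-33984) * N ^ 8) * (i * (i - 1)) ^ 3 +
  ((905) + (-8650) * N ^ 1 + (32288) * N ^ 2 + (-59112) * N ^ 3 + (56763) * N ^ 4 + (-27522) * N ^ 5 + (5328) * N ^ 6) * (i * (i - 1)) ^ 4 +
  ((-95) + (730) * N ^ 1 + (-1942) * N ^ 2 + (1956) * N ^ 3 + (-672) * N ^ 4) * (i * (i - 1)) ^ 5 +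
  ((5) + (-30) * N ^ 1 + (48) * N ^ 2) * (i * (i - 1)) ^ 6

lemma cert10_s10 (N i : ℚ) :
    (-128) * (48 * N ^ 2 - 126 * N + 83) * N ^ 7 * (2 * N - 1) ^ 5 * (N - 1) ^ 3 * (2 * N - 3)
    + 4 * (N - 1) ^ 3 * (2 * N - 3) * (2340 - 23940 * N + 97860 * N ^ 2 - 201624 * N ^ 3
        + 220160 * N ^ 4 - 120768 * N ^ 5 + 26112 * N ^ 6) * ((N + i) * (N - i)) ^ 4
    - 2 * (48 * N ^ 2 - 30 * N + 5) * (((N + i) * (N - i)) ^ 4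
        * ((N + i - 1) * (N - i - 1)) ^ 4)
    = - ((N - i) ^ 4 * X10 N (i + 1)) - (N + i) ^ 4 * X10 N i := by
  unfold X10
  ring

lemma choose_step10 (N k : ℕ) (hk : k ≤ 2 * N) :
    (((2 * (N + 1)).choose (k + 1) : ℕ) : ℚ) * (((k : ℚ) + 1) * (2 * N + 1 - k))
      = ((2 * N + 2) * (2 * N + 1)) * ((2 * N).choose k : ℚ) := by
  have h1 : ((2 * N + 1 + 1 : ℕ) : ℚ) * ((2 * N + 1).choose k : ℚ)
      = ((2 * N + 1 + 1).choose (k + 1) : ℚ) * ((k + 1 : ℕ) : ℚ) := by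
    exact_mod_cast Nat.add_one_mul_choose_eq (2 * N + 1) k
  have h2 : ((2 * N).choose k : ℚ) * ((2 * N + 1 : ℕ) : ℚ)
      = ((2 * N + 1).choose k : ℚ) * ((2 * N + 1 - k : ℕ) : ℚ) := by
    exact_mod_cast Nat.choose_mul_succ_eq (2 * N) k
  rw [Nat.cast_sub (by omega)] at h2
  push_cast at h1 h2
  have e : 2 * (N + 1) = 2 * N + 1 + 1 := by ring
  rw [e]
  linear_combination (-(2 * (N : ℚ) + 1 - k)) * h1 - (2 * (N : ℚ) + 2) * h2

lemma shift10 (N : ℕ) (g : ℚ → ℚ) :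
    ∑ k ∈ Finset.range (2 * (N + 1) + 1),
      (-1 : ℚ) ^ (k + (N + 1)) * (((2 * (N + 1)).choose k : ℚ)) ^ 4
        * (((k : ℚ) * (2 * ((N : ℚ) + 1) - k)) ^ 4 * g k)
      = ((2 * N + 2) * (2 * N + 1)) ^ 4 * ∑ k ∈ Finset.range (2 * N + 1),
        (-1 : ℚ) ^ (k + N) * (((2 * N).choose k : ℚ)) ^ 4 * g (k + 1) := by
  rw [Finset.sum_range_succ, show 2 * (N + 1) = (2 * N + 1) + 1 by ring,
    Finset.sum_range_succ', Finset.mul_sum]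
  have z : (2 * ((N : ℚ) + 1) - ((2 * N + 1 + 1 : ℕ) : ℚ)) = 0 := by push_cast; ring
  rw [z]
  simp only [Nat.cast_zero, zero_mul, mul_zero, ne_eq, OfNat.ofNat_ne_zero, not_false_eq_true,
    zero_pow, add_zero]
  refine Finset.sum_congr rfl fun k hk => ?_
  have h := choose_step10 N k (by have := Finset.mem_range.mp hk; omega)
  rw [show 2 * (N + 1) = (2 * N + 1) + 1 by ring] at h
  have h4 := congrArg (fun x : ℚ => x ^ 4) h
  beta_reduce at h4
  push_cast
  have s : (-1 : ℚ) ^ (k + 1 + (N + 1)) = (-1) ^ (k + N) := by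
    rw [show k + 1 + (N + 1) = k + N + 2 by ring, pow_add]; norm_num
  rw [s]
  linear_combination ((-1 : ℚ) ^ (k + N) * g (k + 1)) * h4

lemma tele10 (N : ℕ) (X : ℚ → ℚ) :
    ∑ k ∈ Finset.range (2 * N + 1),
      (-1 : ℚ) ^ (k + N) * (((2 * N).choose k : ℚ)) ^ 4
        * (- ((2 * N - k) ^ 4 * X (k + 1)) - (k : ℚ) ^ 4 * X k) = 0 := by
  have h := Finset.sum_range_sub (fun k : ℕ =>
    (-1 : ℚ) ^ (k + N) * (((2 * N).choose k : ℚ)) ^ 4 * ((k : ℚ) ^ 4 * X k)) (2 * N + 1)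
  simp only [Nat.choose_succ_self, Nat.cast_zero, ne_eq, OfNat.ofNat_ne_zero,
    not_false_eq_true, zero_pow, zero_mul, mul_zero, sub_zero] at h
  rw [← h]
  refine Finset.sum_congr rfl fun k hk => ?_
  have hk' : k ≤ 2 * N := by have := Finset.mem_range.mp hk; omega
  have h1 : ((2 * N).choose (k + 1) : ℚ) * ((k + 1 : ℕ) : ℚ)
      = ((2 * N).choose k : ℚ) * ((2 * N - k : ℕ) : ℚ) := by
    exact_mod_cast Nat.choose_succ_right_eq (2 * N) k
  rw [Nat.cast_sub hk'] at h1
  push_cast at h1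
  have h4 := congrArg (fun x : ℚ => x ^ 4) h1
  beta_reduce at h4
  push_cast
  have s : (-1 : ℚ) ^ (k + 1 + N) = - (-1) ^ (k + N) := by
    rw [show k + 1 + N = k + N + 1 by ring, pow_succ]; ring
  rw [s]
  linear_combination ((-1 : ℚ) ^ (k + N) * X (k + 1)) * h4

lemma recS10 (n : ℕ) (N : ℚ) (hN : N = n + 2) :
    16 * (48 * N ^ 2 - 126 * N + 83) * N ^ 3 * (2 * N - 1) * S10 (n + 2)
      = 8 * (2340 - 23940 * N + 97860 * N ^ 2 - 201624 * N ^ 3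
        + 220160 * N ^ 4 - 120768 * N ^ 5 + 26112 * N ^ 6) * S10 (n + 1)
      - 64 * (48 * N ^ 2 - 30 * N + 5) * (N - 1) * (2 * N - 3) ^ 3 * S10 n := by
  have hn0 : (0 : ℚ) ≤ n := Nat.cast_nonneg n
  have hT := tele10 (n + 2) (fun k => X10 N (k - N))
  have h1 := shift10 (n + 1) (fun _ => 1)
  have h2 := shift10 (n + 1) (fun k => ((k - 1) * (2 * N - 1 - k)) ^ 4)
  have h3 := shift10 n (fun _ => 1)
  have e3 : ∑ k ∈ Finset.range (2 * (n + 1) + 1), (-1 : ℚ) ^ (k + (n + 1)) *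
      (((2 * (n + 1)).choose k : ℚ)) ^ 4 *
        (((k : ℚ) + 1 - 1) * (2 * N - 1 - ((k : ℚ) + 1))) ^ 4
      = ((2 * n + 2) * (2 * n + 1)) ^ 4 * S10 n := by
    simp only [mul_one] at h3
    rw [S10, ← h3]
    refine Finset.sum_congr rfl fun k _ => ?_
    rw [hN]; ring
  simp only [mul_one] at h1
  rw [e3] at h2
  rw [← S10] at h1
  have hsum : ∑ k ∈ Finset.range (2 * (n + 2) + 1),
      (-1 : ℚ) ^ (k + (n + 2)) * (((2 * (n + 2)).choose k : ℚ)) ^ 4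
        * (- ((2 * ((n + 2 : ℕ) : ℚ) - k) ^ 4 * X10 N (k + 1 - N)) - (k : ℚ) ^ 4 * X10 N (k - N))
      = (-128) * (48 * N ^ 2 - 126 * N + 83) * N ^ 7 * (2 * N - 1) ^ 5 * (N - 1) ^ 3
          * (2 * N - 3) * S10 (n + 2)
        + 4 * (N - 1) ^ 3 * (2 * N - 3) * (2340 - 23940 * N + 97860 * N ^ 2 - 201624 * N ^ 3
          + 220160 * N ^ 4 - 120768 * N ^ 5 + 26112 * N ^ 6) *
          (((2 * N) * (2 * N - 1)) ^ 4 * S10 (n + 1))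
        - 2 * (48 * N ^ 2 - 30 * N + 5) * (((2 * N) * (2 * N - 1)) ^ 4 *
          (((2 * N - 2) * (2 * N - 3)) ^ 4 * S10 n)) := by
    have c1 : (2 * ((n + 1 : ℕ) : ℚ) + 2) * (2 * ((n + 1 : ℕ) : ℚ) + 1)
      = (2 * N) * (2 * N - 1) := by rw [hN]; push_cast; ring
    have c2 : (2 * (n : ℚ) + 2) * (2 * (n : ℚ) + 1)
      = (2 * N - 2) * (2 * N - 3) := by rw [hN]; ring
    rw [c1] at h1 h2
    rw [c2] at h2
    rw [← h2, ← h1, S10, Finset.mul_sum, Finset.mul_sum, Finset.mul_sum,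
      ← Finset.sum_add_distrib, ← Finset.sum_sub_distrib]
    refine Finset.sum_congr rfl fun k _ => ?_
    have hc := cert10_s10 N (k - N)
    have a1 : (k : ℚ) - N + 1 = k + 1 - N := by ring
    have a2 : N + ((k : ℚ) - N) = k := by ring
    have a3 : N - ((k : ℚ) - N) = 2 * N - k := by ring
    have a4 : 2 * ((n + 2 : ℕ) : ℚ) = 2 * N := by rw [hN]; push_cast; ring
    have a5 : 2 * (((n + 1 : ℕ) : ℚ) + 1) = 2 * N := by rw [hN]; push_cast; ring
    rw [a1, a2, a3] at hc
    rw [a4, a5, ← hc]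
    ring
  rw [hsum] at hT
  have hne : 8 * N ^ 4 * (2 * N - 1) ^ 4 * (N - 1) ^ 3 * (2 * N - 3) ≠ 0 := by
    have p1 : 0 < N := by linarith
    have p2 : 0 < 2 * N - 1 := by linarith
    have p3 : 0 < N - 1 := by linarith
    have p4 : 0 < 2 * N - 3 := by linarith
    positivity
  apply mul_left_cancel₀ hne
  linear_combination -hT

lemma A10_nat (n : ℕ) : A10 (n : ℤ) = ((2 * n).choose n : ℚ) * S10 n := rfl

lemma central10 (n : ℕ) : ((n : ℚ) + 1) * ((2 * (n + 1)).choose (n + 1) : ℚ)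
    = 2 * (2 * n + 1) * ((2 * n).choose n : ℚ) := by
  have h := Nat.succ_mul_centralBinom_succ n
  simp only [Nat.centralBinom_eq_two_mul_choose] at h
  exact_mod_cast h

lemma recA10 (n : ℕ) (N : ℚ) (hN : N = n + 2) :
    (48 * N ^ 2 - 126 * N + 83) * N ^ 4 * A10 ((n + 2 : ℕ) : ℤ)
      = (2340 - 23940 * N + 97860 * N ^ 2 - 201624 * N ^ 3
        + 220160 * N ^ 4 - 120768 * N ^ 5 + 26112 * N ^ 6) * A10 ((n + 1 : ℕ) : ℤ)
      - 16 * (48 * N ^ 2 - 30 * N + 5) * (2 * N - 3) ^ 4 * A10 (n : ℤ) := by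
  have hn0 : (0 : ℚ) ≤ n := Nat.cast_nonneg n
  have hS := recS10 n N hN
  rw [A10_nat, A10_nat, A10_nat]
  have b1 := central10 n
  have b2 := central10 (n + 1)
  rw [show n + 1 + 1 = n + 2 by ring] at b2
  push_cast at b2
  rw [show (n : ℚ) = N - 2 by rw [hN]; ring] at b1 b2
  generalize ((2 * n).choose n : ℚ) = u0 at *
  generalize ((2 * (n + 1)).choose (n + 1) : ℚ) = u1 at *
  generalize ((2 * (n + 2)).choose (n + 2) : ℚ) = u2 at *
  have p2 : 0 < 2 * N - 1 := by linarith
  have hne : 16 * (2 * N - 1) ≠ 0 := by positivity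
  apply mul_left_cancel₀ hne
  linear_combination u2 * N * hS + 8 * (2340 - 23940 * N + 97860 * N ^ 2 - 201624 * N ^ 3
        + 220160 * N ^ 4 - 120768 * N ^ 5 + 26112 * N ^ 6) * S10 (n + 1) * b2
    - 64 * (48 * N ^ 2 - 30 * N + 5) * (2 * N - 3) ^ 3 * S10 n *
      ((N - 1) * b2 + 2 * (2 * N - 1) * b1)

lemma A10_val0 : A10 0 = 1 := by
  change A10 ((0 : ℕ) : ℤ) = _
  rw [A10_nat, S10]
  norm_num [Finset.sum_range_succ, Nat.choose]

lemma A10_val1 : A10 1 = 28 := by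
  change A10 ((1 : ℕ) : ℤ) = _
  rw [A10_nat, S10]
  norm_num [Finset.sum_range_succ, Nat.choose]

lemma A10_val2 : A10 2 = 4716 := by
  change A10 ((2 : ℕ) : ℤ) = _
  rw [A10_nat, S10]
  norm_num [Finset.sum_range_succ, Nat.choose]

lemma A10_val3 : A10 3 = 1226800 := by
  change A10 ((3 : ℕ) : ℤ) = _
  rw [A10_nat, S10]
  norm_num [Finset.sum_range_succ, Nat.choose]

lemma A10_neg (n : ℕ) : A10 (Int.negSucc n) = 0 := rfl

/-- The coefficients of the fundamental period of the degree 10 pfaffian mirror family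
satisfy the recurrence coming from the Picard–Fuchs operator
`5²Θ⁴ − 2²·5·φ·q₁(Θ) + 2⁴φ²·q₂(Θ) − 2¹⁰φ³·q₃(Θ) + 2¹²φ⁴(2Θ+1)⁴`. -/
theorem A10_recurrence (n : ℤ) (hn : 1 ≤ n) :
    25 * (n : ℚ) ^ 4 * A10 n =
      20 * (688 * ((n : ℚ) - 1) ^ 4 + 1352 * ((n : ℚ) - 1) ^ 3 +
          981 * ((n : ℚ) - 1) ^ 2 + 305 * ((n : ℚ) - 1) + 35) * A10 (n - 1)
        - 16 * (5856 * ((n : ℚ) - 2) ^ 4 + 7008 * ((n : ℚ) - 2) ^ 3 +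
            96 * ((n : ℚ) - 2) ^ 2 - 1260 * ((n : ℚ) - 2) - 265) * A10 (n - 2)
        + 1024 * (176 * ((n : ℚ) - 3) ^ 4 + 120 * ((n : ℚ) - 3) ^ 3 +
            69 * ((n : ℚ) - 3) ^ 2 + 30 * ((n : ℚ) - 3) + 5) * A10 (n - 3)
        - 4096 * (2 * (n : ℚ) - 7) ^ 4 * A10 (n - 4) := by
  obtain ⟨m, rfl⟩ : ∃ m : ℕ, n = (m : ℤ) + 1 := ⟨(n - 1).toNat, by omega⟩
  match m with
  | 0 =>
    have v1 : A10 ((((0 : ℕ) : ℤ) + 1) - 1) = 1 := A10_val0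
    have v2 : A10 ((((0 : ℕ) : ℤ) + 1) - 2) = 0 := rfl
    have v3 : A10 ((((0 : ℕ) : ℤ) + 1) - 3) = 0 := rfl
    have v4 : A10 ((((0 : ℕ) : ℤ) + 1) - 4) = 0 := rfl
    have v0 : A10 (((0 : ℕ) : ℤ) + 1) = 28 := A10_val1
    rw [v0, v1, v2, v3, v4]; norm_num
  | 1 =>
    have v1 : A10 ((((1 : ℕ) : ℤ) + 1) - 1) = 28 := A10_val1
    have v2 : A10 ((((1 : ℕ) : ℤ) + 1) - 2) = 1 := A10_val0
    have v3 : A10 ((((1 : ℕ) : ℤ) + 1) - 3) = 0 := rfl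
    have v4 : A10 ((((1 : ℕ) : ℤ) + 1) - 4) = 0 := rfl
    have v0 : A10 (((1 : ℕ) : ℤ) + 1) = 4716 := A10_val2
    rw [v0, v1, v2, v3, v4]; norm_num
  | 2 =>
    have v1 : A10 ((((2 : ℕ) : ℤ) + 1) - 1) = 4716 := A10_val2
    have v2 : A10 ((((2 : ℕ) : ℤ) + 1) - 2) = 28 := A10_val1
    have v3 : A10 ((((2 : ℕ) : ℤ) + 1) - 3) = 1 := A10_val0
    have v4 : A10 ((((2 : ℕ) : ℤ) + 1) - 4) = 0 := rfl
    have v0 : A10 (((2 : ℕ) : ℤ) + 1) = 1226800 := A10_val3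
    rw [v0, v1, v2, v3, v4]; norm_num
  | (m + 3) =>
    have hm0 : (0 : ℚ) ≤ m := Nat.cast_nonneg m
    have r0 := recA10 m _ rfl
    have r1 := recA10 (m + 1) _ rfl
    have r2 := recA10 (m + 2) _ rfl
    rw [show (((m + 3 : ℕ) : ℤ) + 1) - 1 = ((m + 3 : ℕ) : ℤ) by push_cast; ring,
      show (((m + 3 : ℕ) : ℤ) + 1) - 2 = ((m + 2 : ℕ) : ℤ) by push_cast; ring,
      show (((m + 3 : ℕ) : ℤ) + 1) - 3 = ((m + 1 : ℕ) : ℤ) by push_cast; ring,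
      show (((m + 3 : ℕ) : ℤ) + 1) - 4 = (m : ℤ) by push_cast; ring,
      show (((m + 3 : ℕ) : ℤ) + 1) = ((m + 4 : ℕ) : ℤ) by push_cast; ring]
    rw [show m + 1 + 2 = m + 3 by ring, show m + 1 + 1 = m + 2 by ring] at r1
    rw [show m + 2 + 2 = m + 4 by ring, show m + 2 + 1 = m + 3 by ring] at r2
    generalize A10 ((m + 4 : ℕ) : ℤ) = x4 at *
    generalize A10 ((m + 3 : ℕ) : ℤ) = x3 at *
    generalize A10 ((m + 2 : ℕ) : ℤ) = x2 at *
    generalize A10 ((m + 1 : ℕ) : ℤ) = x1 at *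
    generalize A10 (m : ℤ) = x0 at *
    push_cast at *
    generalize (m : ℚ) = t at *
    have hne : (48 * (t + 3) ^ 2 - 30 * (t + 3) + 5) * (48 * (t + 2) ^ 2 - 30 * (t + 2) + 5) ≠ 0 := by
      have p1 : 0 < 48 * (t + 3) ^ 2 - 30 * (t + 3) + 5 := by nlinarith
      have p2 : 0 < 48 * (t + 2) ^ 2 - 30 * (t + 2) + 5 := by nlinarith
      positivity
    apply mul_left_cancel₀ hne
    linear_combination 25 * (48 * (t + 2) ^ 2 - 30 * (t + 2) + 5) * r2
      + (-19520 + 27840 * (t + 4) - 7680 * (t + 4) ^ 2) * r1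
      + 256 * (48 * (t + 3) ^ 2 - 30 * (t + 3) + 5) * r0
end

section
/- Let R be a commutative ring containing an element ζ with ζ¹³ = 1, and consider the polynomials P₁,…,P₅ in R[x₀,…,x₆,t]. The R[t]-algebra endomorphism of R[x₀,…,x₆,t] determined by x₀ ↦ x₀, x₁ ↦ ζ⁴x₁, x₂ ↦ ζ⁸x₂, x₃ ↦ ζ¹⁰x₃, x₄ ↦ ζ¹⁰x₄, x₅ ↦ ζ¹¹x₅, x₆ ↦ ζ¹¹x₆ sends P₁ ↦ ζ⁸P₁, P₂ ↦ ζ⁷P₂, P₃ ↦ ζ¹¹P₃, P₄ ↦ P₄, and P₅ ↦ ζ⁴P₅. In particular, the ideal (P₁,…,P₅) is invariant under this ℤ/13-action. -/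
open MvPolynomial

/-- The five generators `P₁, …, P₅` of the pfaffian ideal of the conjectural mirror
family of the degree 13 pfaffian Calabi–Yau threefold, as polynomials in the variables
`x₀, …, x₆` (indexed by `0, …, 6`) and `t` (indexed by `7`). -/
noncomputable def mirrorP13 (R : Type*) [CommRing R] : Fin 5 → MvPolynomial (Fin 8) R :=
  ![X 0 * X 2 - X 7 * X 1 ^ 2 - X 7 ^ 2 * ((X 3 + X 4) * (X 5 + X 6)),
    X 0 * X 3 * X 4 - X 7 * (X 5 * X 6 * (X 5 + X 6)) - X 7 ^ 2 * (X 1 * X 2 ^ 2),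
    X 1 * X 3 * X 4 - X 7 * X 2 ^ 3 - X 7 ^ 2 * (X 0 ^ 2 * (X 5 + X 6)),
    X 1 * X 5 * X 6 - X 7 * X 0 ^ 3 - X 7 ^ 2 * (X 2 ^ 2 * (X 3 + X 4)),
    X 2 * X 5 * X 6 - X 7 * (X 3 * X 4 * (X 3 + X 4)) - X 7 ^ 2 * (X 0 ^ 2 * X 1)]

/-- The `R[t]`-algebra endomorphism determined by `x₀ ↦ x₀`, `x₁ ↦ ζ⁴x₁`, `x₂ ↦ ζ⁸x₂`,
`x₃ ↦ ζ¹⁰x₃`, `x₄ ↦ ζ¹⁰x₄`, `x₅ ↦ ζ¹¹x₅`, `x₆ ↦ ζ¹¹x₆`, `t ↦ t`. -/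
noncomputable def zAction13 {R : Type*} [CommRing R] (ζ : R) :
    MvPolynomial (Fin 8) R →ₐ[R] MvPolynomial (Fin 8) R :=
  aeval ![X 0, C (ζ ^ 4) * X 1, C (ζ ^ 8) * X 2, C (ζ ^ 10) * X 3, C (ζ ^ 10) * X 4,
    C (ζ ^ 11) * X 5, C (ζ ^ 11) * X 6, X 7]

/-- If `ζ¹³ = 1`, the scaling `x ↦ ζ·x` above sends `P₁ ↦ ζ⁸P₁`, `P₂ ↦ ζ⁷P₂`,
`P₃ ↦ ζ¹¹P₃`, `P₄ ↦ P₄`, `P₅ ↦ ζ⁴P₅`; in particular the ideal `(P₁, …, P₅)` is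
invariant under this `ℤ/13`-action. -/
theorem zAction13_spec {R : Type*} [CommRing R] (ζ : R) (hζ : ζ ^ 13 = 1) :
    (zAction13 ζ (mirrorP13 R 0) = C (ζ ^ 8) * mirrorP13 R 0 ∧
     zAction13 ζ (mirrorP13 R 1) = C (ζ ^ 7) * mirrorP13 R 1 ∧
     zAction13 ζ (mirrorP13 R 2) = C (ζ ^ 11) * mirrorP13 R 2 ∧
     zAction13 ζ (mirrorP13 R 3) = mirrorP13 R 3 ∧
     zAction13 ζ (mirrorP13 R 4) = C (ζ ^ 4) * mirrorP13 R 4) ∧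
    Ideal.map (zAction13 ζ) (Ideal.span (Set.range (mirrorP13 R))) ≤
      Ideal.span (Set.range (mirrorP13 R)) := by
  have hz : (C ζ : MvPolynomial (Fin 8) R) ^ 13 = 1 := by
    rw [← C_pow, hζ, C_1]
  have h : zAction13 ζ (mirrorP13 R 0) = C (ζ ^ 8) * mirrorP13 R 0 ∧
     zAction13 ζ (mirrorP13 R 1) = C (ζ ^ 7) * mirrorP13 R 1 ∧
     zAction13 ζ (mirrorP13 R 2) = C (ζ ^ 11) * mirrorP13 R 2 ∧
     zAction13 ζ (mirrorP13 R 3) = mirrorP13 R 3 ∧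
     zAction13 ζ (mirrorP13 R 4) = C (ζ ^ 4) * mirrorP13 R 4 := by
    have e0 : zAction13 ζ (X 0) = X 0 := by simp [zAction13]
    have e1 : zAction13 ζ (X 1) = C ζ ^ 4 * X 1 := by simp [zAction13]
    have e2 : zAction13 ζ (X 2) = C ζ ^ 8 * X 2 := by simp [zAction13]
    have e3 : zAction13 ζ (X 3) = C ζ ^ 10 * X 3 := by simp [zAction13]
    have e4 : zAction13 ζ (X 4) = C ζ ^ 10 * X 4 := by simp [zAction13]
    have e5 : zAction13 ζ (X 5) = C ζ ^ 11 * X 5 := by simp [zAction13]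
    have e6 : zAction13 ζ (X 6) = C ζ ^ 11 * X 6 := by simp [zAction13]
    have e7 : zAction13 ζ (X 7) = X 7 := by simp [zAction13]
    have p0 : mirrorP13 R 0 =
      X 0 * X 2 - X 7 * X 1 ^ 2 - X 7 ^ 2 * ((X 3 + X 4) * (X 5 + X 6)) := rfl
    have p1 : mirrorP13 R 1 = X 0 * X 3 * X 4 - X 7 * (X 5 * X 6 * (X 5 + X 6))
      - X 7 ^ 2 * (X 1 * X 2 ^ 2) := rfl
    have p2 : mirrorP13 R 2 =
      X 1 * X 3 * X 4 - X 7 * X 2 ^ 3 - X 7 ^ 2 * (X 0 ^ 2 * (X 5 + X 6)) := rfl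
    have p3 : mirrorP13 R 3 =
      X 1 * X 5 * X 6 - X 7 * X 0 ^ 3 - X 7 ^ 2 * (X 2 ^ 2 * (X 3 + X 4)) := rfl
    have p4 : mirrorP13 R 4 = X 2 * X 5 * X 6 - X 7 * (X 3 * X 4 * (X 3 + X 4))
      - X 7 ^ 2 * (X 0 ^ 2 * X 1) := rfl
    rw [p0, p1, p2, p3, p4]
    simp only [map_sub, map_mul, map_add, map_pow, e0, e1, e2, e3, e4, e5, e6, e7]
    generalize (C ζ : MvPolynomial (Fin 8) R) = z at hz
    refine ⟨?_, ?_, ?_, ?_, ?_⟩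
    · linear_combination (-(X 7 ^ 2 * ((X 3 + X 4) * (X 5 + X 6))) * z ^ 8) * hz
    · linear_combination (z ^ 7 * (X 0 * X 3 * X 4 - X 7 ^ 2 * (X 1 * X 2 ^ 2)
        - X 7 * (X 5 * X 6 * (X 5 + X 6)) * (z ^ 13 + 1))) * hz
    · linear_combination (z ^ 11 * (X 1 * X 3 * X 4 - X 7 * X 2 ^ 3)) * hz
    · linear_combination ((z ^ 13 + 1) *
        (X 1 * X 5 * X 6 - X 7 ^ 2 * (X 2 ^ 2 * (X 3 + X 4)))) * hz
    · linear_combination (z ^ 4 * (z ^ 13 + 1) *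
        (X 2 * X 5 * X 6 - X 7 * (X 3 * X 4 * (X 3 + X 4)))) * hz
  refine ⟨h, ?_⟩
  obtain ⟨h0, h1, h2, h3, h4⟩ := h
  rw [Ideal.map_span, Ideal.span_le]
  rintro _ ⟨_, ⟨i, rfl⟩, rfl⟩
  have hm : ∀ j, mirrorP13 R j ∈ Ideal.span (Set.range (mirrorP13 R)) :=
    fun j => Ideal.subset_span ⟨j, rfl⟩
  rw [SetLike.mem_coe]
  have key : ∃ c, zAction13 ζ (mirrorP13 R i) = c * mirrorP13 R i := by
    fin_cases i
    · exact ⟨_, h0⟩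
    · exact ⟨_, h1⟩
    · exact ⟨_, h2⟩
    · exact ⟨1, h3.trans (one_mul _).symm⟩
    · exact ⟨_, h4⟩
  obtain ⟨c, hc⟩ := key
  have := Ideal.mul_mem_left _ c (hm i)
  rw [← hc] at this
  exact this
end

section
/- Let R be a commutative ring containing an element ζ with ζ⁷ = 1, and consider the polynomials P₁,…,P₅ in R[x₀,…,x₆,t]. Let σ be the R-algebra endomorphism of R[x₀,…,x₆,t] determined by x₀ ↦ x₀, x₁ ↦ ζ³x₁, x₂ ↦ x₂, x₃ ↦ ζ⁶x₃, x₄ ↦ ζ⁶x₄, x₅ ↦ ζ⁶x₅, x₆ ↦ ζ⁶x₆, t ↦ t, and let τ be the substitution t ↦ ζ⁶t (fixing x₀,…,x₆). Then σ(P₁) = τ(P₁), σ(P₂) = ζ⁵·τ(P₂), σ(P₃) = ζ·τ(P₃), σ(P₄) = ζ·τ(P₄), and σ(P₅) = ζ⁵·τ(P₅). In particular, the coordinate scaling σ identifies the zero locus of (P₁,…,P₅) at parameter ζ⁶t with the zero locus at parameter t, so the family is not effectively parametrized by t. -/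
open MvPolynomial

/-- The coordinate scaling `σ`: `x₀ ↦ x₀`, `x₁ ↦ ζ³x₁`, `x₂ ↦ x₂`, `x₃ ↦ ζ⁶x₃`,
`x₄ ↦ ζ⁶x₄`, `x₅ ↦ ζ⁶x₅`, `x₆ ↦ ζ⁶x₆`, `t ↦ t`. -/
noncomputable def sigma13 {R : Type*} [CommRing R] (ζ : R) :
    MvPolynomial (Fin 8) R →ₐ[R] MvPolynomial (Fin 8) R :=
  aeval ![X 0, C (ζ ^ 3) * X 1, X 2, C (ζ ^ 6) * X 3, C (ζ ^ 6) * X 4,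
    C (ζ ^ 6) * X 5, C (ζ ^ 6) * X 6, X 7]

/-- The parameter substitution `τ`: `t ↦ ζ⁶t`, fixing `x₀, …, x₆`. -/
noncomputable def tau13 {R : Type*} [CommRing R] (ζ : R) :
    MvPolynomial (Fin 8) R →ₐ[R] MvPolynomial (Fin 8) R :=
  aeval ![X 0, X 1, X 2, X 3, X 4, X 5, X 6, C (ζ ^ 6) * X 7]

/-- If `ζ⁷ = 1`, then `σ(P₁) = τ(P₁)`, `σ(P₂) = ζ⁵·τ(P₂)`, `σ(P₃) = ζ·τ(P₃)`,
`σ(P₄) = ζ·τ(P₄)`, `σ(P₅) = ζ⁵·τ(P₅)`; in particular the coordinate scaling `σ`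
identifies the fiber of the family at parameter `ζ⁶t` with the fiber at parameter `t`,
so the family is not effectively parametrized by `t`. -/
theorem sigma13_tau13_spec {R : Type*} [CommRing R] (ζ : R) (hζ : ζ ^ 7 = 1) :
    sigma13 ζ (mirrorP13 R 0) = tau13 ζ (mirrorP13 R 0) ∧
    sigma13 ζ (mirrorP13 R 1) = C (ζ ^ 5) * tau13 ζ (mirrorP13 R 1) ∧
    sigma13 ζ (mirrorP13 R 2) = C ζ * tau13 ζ (mirrorP13 R 2) ∧
    sigma13 ζ (mirrorP13 R 3) = C ζ * tau13 ζ (mirrorP13 R 3) ∧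
    sigma13 ζ (mirrorP13 R 4) = C (ζ ^ 5) * tau13 ζ (mirrorP13 R 4) := by
  have hz : (C ζ : MvPolynomial (Fin 8) R) ^ 7 = 1 := by
    rw [← C_pow, hζ, C_1]
  simp only [sigma13, tau13, mirrorP13, Matrix.cons_val, map_sub, map_add, map_mul, map_pow,
    aeval_X]
  generalize (C ζ : MvPolynomial (Fin 8) R) = z at hz
  refine ⟨by ring, ?_, ?_, ?_, ?_⟩
  · linear_combination (z ^ 5 * (X 0 * X 3 * X 4) - z ^ 11 * (X 7 * (X 5 * X 6 * (X 5 + X 6)))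
      + (z ^ 10 + z ^ 3) * (X 7 ^ 2 * (X 1 * X 2 ^ 2))) * hz
  · linear_combination ((z ^ 8 + z) * (X 1 * X 3 * X 4) + X 7 * X 2 ^ 3
      + z ^ 6 * (X 7 ^ 2 * (X 0 ^ 2 * (X 5 + X 6)))) * hz
  · linear_combination ((z ^ 8 + z) * (X 1 * X 5 * X 6) + X 7 * X 0 ^ 3
      + z ^ 6 * (X 7 ^ 2 * (X 2 ^ 2 * (X 3 + X 4)))) * hz
  · linear_combination (z ^ 5 * (X 2 * X 5 * X 6) - z ^ 11 * (X 7 * (X 3 * X 4 * (X 3 + X 4)))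
      + (z ^ 10 + z ^ 3) * (X 7 ^ 2 * (X 0 ^ 2 * X 1))) * hz
end

section
/- Let f = x⁴ + y² + z²w + zw² and g = x⁸ + y² + zw in ℂ[x, y, z, w], with Jacobian ideals J_f = (4x³, 2y, 2zw + w², z² + 2zw) and J_g = (8x⁷, 2y, w, z). Then the quotient ring ℂ[x, y, z, w]/J_f is a ℂ-vector space of dimension 12 and ℂ[x, y, z, w]/J_g is a ℂ-vector space of dimension 7; that is, the Milnor numbers of the cDV singularities f = 0 and g = 0 at the origin are 12 and 7, respectively. -/
open MvPolynomial

/-- The cDV singularity `f = x⁴ + y² + z²w + zw²` (variables `x, y, z, w` indexed by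
`0, 1, 2, 3`), the germ of the degree 10 pfaffian mirror family at its four singular
points of multiplicity 12. -/
noncomputable def milnorF10 : MvPolynomial (Fin 4) ℂ :=
  X 0 ^ 4 + X 1 ^ 2 + X 2 ^ 2 * X 3 + X 2 * X 3 ^ 2

/-- The cDV singularity `g = x⁸ + y² + zw`, the germ of the degree 10 pfaffian mirror
family at its two singular points of multiplicity 7. -/
noncomputable def milnorG10 : MvPolynomial (Fin 4) ℂ :=
  X 0 ^ 8 + X 1 ^ 2 + X 2 * X 3

/-- The Jacobian ideal of `f = x⁴ + y² + z²w + zw²`. -/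
noncomputable def jacobianIdealF10 : Ideal (MvPolynomial (Fin 4) ℂ) :=
  Ideal.span (Set.range fun i => pderiv i milnorF10)

/-- The Jacobian ideal of `g = x⁸ + y² + zw`. -/
noncomputable def jacobianIdealG10 : Ideal (MvPolynomial (Fin 4) ℂ) :=
  Ideal.span (Set.range fun i => pderiv i milnorG10)

/-- If `b` has a dual family of functionals vanishing on `J` and its span mod `J` contains `1` and
is stable under the variables, then the classes of `b` form a basis of the quotient. -/
lemma quot_dim {ι : Type} [Fintype ι] [DecidableEq ι] (J : Ideal (MvPolynomial (Fin 4) ℂ))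
    (b : ι → MvPolynomial (Fin 4) ℂ) (φ : ι → MvPolynomial (Fin 4) ℂ →ₗ[ℂ] ℂ)
    (hJ : ∀ j, ∀ p ∈ J, φ j p = 0)
    (hb : ∀ i j, φ j (b i) = if i = j then 1 else 0)
    (h1 : (1 : MvPolynomial (Fin 4) ℂ ⧸ J) ∈
      Submodule.span ℂ (Set.range fun i => Ideal.Quotient.mk J (b i)))
    (hX : ∀ k i, Ideal.Quotient.mk J (b i) * Ideal.Quotient.mk J (X k) ∈
      Submodule.span ℂ (Set.range fun i => Ideal.Quotient.mk J (b i))) :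
    FiniteDimensional ℂ (MvPolynomial (Fin 4) ℂ ⧸ J) ∧
      Module.finrank ℂ (MvPolynomial (Fin 4) ℂ ⧸ J) = Fintype.card ι := by
  have hsm : ∀ (c : ℂ) (p : MvPolynomial (Fin 4) ℂ),
      Ideal.Quotient.mk J (c • p) = c • Ideal.Quotient.mk J p := fun c p => rfl
  have hli : LinearIndependent ℂ (fun i => Ideal.Quotient.mk J (b i)) := by
    rw [Fintype.linearIndependent_iff]
    intro g hg j
    have h2 : Ideal.Quotient.mk J (∑ i, g i • b i) = 0 := by
      rw [map_sum]; exact hg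
    have h3 := hJ j _ (Ideal.Quotient.eq_zero_iff_mem.mp h2)
    simpa [map_sum, hb] using h3
  set T := Submodule.span ℂ (Set.range fun i => Ideal.Quotient.mk J (b i)) with hT
  have hmul : ∀ k, ∀ q ∈ T, q * Ideal.Quotient.mk J (X k) ∈ T := by
    intro k q hq
    induction hq using Submodule.span_induction with
    | mem x hx => obtain ⟨i, rfl⟩ := hx; exact hX k i
    | zero => simp
    | add x y _ _ hx hy => rw [add_mul]; exact T.add_mem hx hy
    | smul c x _ hx => rw [smul_mul_assoc]; exact T.smul_mem c hx
  have hall : ∀ p, Ideal.Quotient.mk J p ∈ T := by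
    intro p
    induction p using MvPolynomial.induction_on with
    | C a =>
      have : (C a : MvPolynomial (Fin 4) ℂ) = a • 1 := by simp [MvPolynomial.smul_eq_C_mul]
      rw [this, hsm]
      exact T.smul_mem a h1
    | add p q hp hq => rw [map_add]; exact T.add_mem hp hq
    | mul_X p k hp => rw [map_mul]; exact hmul k _ hp
  have htop : ⊤ ≤ T := by
    intro q _
    obtain ⟨p, rfl⟩ := Ideal.Quotient.mk_surjective q
    exact hall p
  let B := Module.Basis.mk hli htop
  exact ⟨B.finiteDimensional_of_finite, Module.finrank_eq_card_basis B⟩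

/-- Exponent vectors. -/
noncomputable def ev (a b c d : ℕ) : Fin 4 →₀ ℕ := Finsupp.equivFunOnFinite.symm ![a, b, c, d]

/-- Coefficient functional at an exponent vector. -/
noncomputable def cf (a b c d : ℕ) : MvPolynomial (Fin 4) ℂ →ₗ[ℂ] ℂ :=
  MvPolynomial.lcoeff ℂ (ev a b c d)

lemma cf_one (a b c d : ℕ) : cf a b c d 1 = if a = 0 ∧ b = 0 ∧ c = 0 ∧ d = 0 then 1 else 0 := by
  simp only [cf, lcoeff_apply, coeff_one]
  congr 1
  simp [ev, DFunLike.ext_iff, Fin.forall_fin_succ, eq_comm]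

lemma cf_x (p) (a b c d : ℕ) : cf (a+1) b c d (p * X 0) = cf a b c d p := by
  have : ev (a+1) b c d = ev a b c d + Finsupp.single 0 1 := by
    ext i; fin_cases i <;> simp [ev]
  simp [cf, this]
lemma cf_y (p) (a b c d : ℕ) : cf a (b+1) c d (p * X 1) = cf a b c d p := by
  have : ev a (b+1) c d = ev a b c d + Finsupp.single 1 1 := by
    ext i; fin_cases i <;> simp [ev]
  simp [cf, this]
lemma cf_z (p) (a b c d : ℕ) : cf a b (c+1) d (p * X 2) = cf a b c d p := by
  have : ev a b (c+1) d = ev a b c d + Finsupp.single 2 1 := by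
    ext i; fin_cases i <;> simp [ev]
  simp [cf, this]
lemma cf_w (p) (a b c d : ℕ) : cf a b c (d+1) (p * X 3) = cf a b c d p := by
  have : ev a b c (d+1) = ev a b c d + Finsupp.single 3 1 := by
    ext i; fin_cases i <;> simp [ev]
  simp [cf, this]
lemma cf_x0 (p) (b c d : ℕ) : cf 0 b c d (p * X 0) = 0 := by
  simp [cf, coeff_mul_X', ev]
lemma cf_y0 (p) (a c d : ℕ) : cf a 0 c d (p * X 1) = 0 := by
  simp [cf, coeff_mul_X', ev]
lemma cf_z0 (p) (a b d : ℕ) : cf a b 0 d (p * X 2) = 0 := by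
  simp [cf, coeff_mul_X', ev]
lemma cf_w0 (p) (a b c : ℕ) : cf a b c 0 (p * X 3) = 0 := by
  simp [cf, coeff_mul_X', ev]

lemma ideal_le_ker (J : Ideal (MvPolynomial (Fin 4) ℂ)) (s : Fin 4 → MvPolynomial (Fin 4) ℂ)
    (hs : J = Ideal.span (Set.range s)) (φ : MvPolynomial (Fin 4) ℂ →ₗ[ℂ] ℂ)
    (h : ∀ k p, φ (p * s k) = 0) : ∀ p ∈ J, φ p = 0 := by
  intro p hp
  rw [hs] at hp
  induction hp using Submodule.span_induction with
  | mem x hx => obtain ⟨i, rfl⟩ := hx; simpa using h i 1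
  | zero => simp
  | add x y _ _ hx hy => simp [hx, hy]
  | smul c x hx' _ =>
    rw [smul_eq_mul]
    obtain ⟨l, rfl⟩ := (Submodule.mem_span_range_iff_exists_fun _).mp hx'
    rw [Finset.mul_sum, map_sum]
    refine Finset.sum_eq_zero fun i _ => ?_
    rw [smul_eq_mul, ← mul_assoc]
    exact h i _

/-- Generators of the Jacobian ideal of `f`. -/
noncomputable def genF : Fin 4 → MvPolynomial (Fin 4) ℂ :=
  ![(4 : ℂ) • (X 0 * X 0 * X 0), (2 : ℂ) • X 1, (2 : ℂ) • (X 2 * X 3) + X 3 * X 3,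
    X 2 * X 2 + (2 : ℂ) • (X 2 * X 3)]

/-- Generators of the Jacobian ideal of `g`. -/
noncomputable def genG : Fin 4 → MvPolynomial (Fin 4) ℂ :=
  ![(8 : ℂ) • (X 0 * X 0 * X 0 * X 0 * X 0 * X 0 * X 0), (2 : ℂ) • X 1, X 3, X 2]

lemma jacF : jacobianIdealF10 = Ideal.span (Set.range genF) := by
  unfold jacobianIdealF10
  congr 2
  funext i
  have c2 : (C 2 : MvPolynomial (Fin 4) ℂ) = 2 := map_ofNat C 2
  have c4 : (C 4 : MvPolynomial (Fin 4) ℂ) = 4 := map_ofNat C 4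
  have c8 : (C 8 : MvPolynomial (Fin 4) ℂ) = 8 := map_ofNat C 8
  fin_cases i <;> simp [genF, milnorF10, pderiv_X, MvPolynomial.smul_eq_C_mul, c2, c4, c8] <;>
    ring

lemma jacG : jacobianIdealG10 = Ideal.span (Set.range genG) := by
  unfold jacobianIdealG10
  congr 2
  funext i
  have c2 : (C 2 : MvPolynomial (Fin 4) ℂ) = 2 := map_ofNat C 2
  have c4 : (C 4 : MvPolynomial (Fin 4) ℂ) = 4 := map_ofNat C 4
  have c8 : (C 8 : MvPolynomial (Fin 4) ℂ) = 8 := map_ofNat C 8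
  fin_cases i <;> simp [genG, milnorG10, pderiv_X, MvPolynomial.smul_eq_C_mul, c2, c4, c8] <;>
    ring

lemma cf_X0 (a b c d : ℕ) : cf a b c d (X 0) = cf a b c d (1 * X 0) := by rw [one_mul]
lemma cf_X2 (a b c d : ℕ) : cf a b c d (X 2) = cf a b c d (1 * X 2) := by rw [one_mul]
lemma cf_X3 (a b c d : ℕ) : cf a b c d (X 3) = cf a b c d (1 * X 3) := by rw [one_mul]

/-- The part of the basis in `z, w`. -/
noncomputable def tF : Fin 4 → MvPolynomial (Fin 4) ℂ := ![1, 1 * X 2, 1 * X 3, 1 * X 2 * X 3]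

/-- The dual functionals. -/
noncomputable def dF (i : ℕ) : Fin 4 → MvPolynomial (Fin 4) ℂ →ₗ[ℂ] ℂ :=
  ![cf i 0 0 0, cf i 0 (0+1) 0, cf i 0 0 (0+1),
    cf i 0 (0+1) (0+1) - (2 : ℂ) • cf i 0 (0+1+1) 0 - (2 : ℂ) • cf i 0 0 (0+1+1)]

lemma dF_x0 (k p) : dF 0 k (p * X 0) = 0 := by
  fin_cases k <;> simp [dF, cf_x0]
lemma dF_x (i k p) : dF (i + 1) k (p * X 0) = dF i k p := by
  fin_cases k <;> simp [dF, cf_x]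
lemma dF_y (i k p) : dF i k (p * X 1) = 0 := by
  fin_cases k <;> simp [dF, cf_y0]
lemma dF_z (i k p) : dF i k (p * genF 2) = 0 := by
  fin_cases k <;>
    simp only [Fin.zero_eta, Fin.mk_one, Fin.reduceFinMk, dF, genF, Matrix.cons_val,
      LinearMap.sub_apply, LinearMap.smul_apply, mul_add, mul_smul_comm, ← mul_assoc,
      map_add, map_smul, cf_z, cf_w, cf_z0, cf_w0, smul_eq_mul] <;> ring
lemma dF_w (i k p) : dF i k (p * genF 3) = 0 := by
  fin_cases k <;>
    simp only [Fin.zero_eta, Fin.mk_one, Fin.reduceFinMk, dF, genF, Matrix.cons_val,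
      LinearMap.sub_apply, LinearMap.smul_apply, mul_add, mul_smul_comm, ← mul_assoc,
      map_add, map_smul, cf_z, cf_w, cf_z0, cf_w0, smul_eq_mul, mul_right_comm _ (X 2) (X 3)]
      <;> ring

lemma dF_t (i k l) : dF i k (tF l) = if i = 0 ∧ l = k then 1 else 0 := by
  fin_cases k <;> fin_cases l <;>
    simp only [Fin.zero_eta, Fin.mk_one, Fin.reduceFinMk, dF, tF, Matrix.cons_val,
      LinearMap.sub_apply, LinearMap.smul_apply, 
      cf_z, cf_w, cf_z0, cf_w0, smul_eq_mul, cf_one] <;> simp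

lemma dF_pow (i j k l) : dF i k (tF l * X 0 ^ j) = if j = i ∧ l = k then 1 else 0 := by
  induction j generalizing i with
  | zero => simp [dF_t, eq_comm]
  | succ j ih =>
    rw [pow_succ, ← mul_assoc]
    cases i with
    | zero => simp [dF_x0]
    | succ i => simp [dF_x, ih]

lemma partF : FiniteDimensional ℂ (MvPolynomial (Fin 4) ℂ ⧸ jacobianIdealF10) ∧
      Module.finrank ℂ (MvPolynomial (Fin 4) ℂ ⧸ jacobianIdealF10) = 12 := by
  have hg : ∀ k, Ideal.Quotient.mk jacobianIdealF10 (genF k) = 0 := fun k => by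
    rw [Ideal.Quotient.eq_zero_iff_mem, jacF]
    exact Ideal.subset_span ⟨k, rfl⟩
  have hsm : ∀ (c : ℂ) (p : MvPolynomial (Fin 4) ℂ), Ideal.Quotient.mk jacobianIdealF10 (c • p)
      = c • Ideal.Quotient.mk jacobianIdealF10 p := fun c p => rfl
  have h0 := hg 0
  have h1 := hg 1
  have h2 := hg 2
  have h3 := hg 3
  simp only [genF, Matrix.cons_val, map_add, hsm, map_mul] at h0 h1 h2 h3
  have hdim : ∀ j : Fin 3 × Fin 4, ∀ p ∈ jacobianIdealF10, dF j.1 j.2 p = 0 := by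
    rintro ⟨i, k⟩
    refine ideal_le_ker _ genF jacF _ ?_
    intro l p
    fin_cases l
    · simp only [Fin.zero_eta, genF, Matrix.cons_val, mul_smul_comm, map_smul, ← mul_assoc]
      fin_cases i
      · simp [dF_x0]
      · simp [dF_x _ _ _, dF_x0, dF_x 0]
      · simp [dF_x _ _ _, dF_x0, dF_x 0, dF_x 1]
    · simp [genF, dF_y]
    · exact dF_z _ _ _
    · exact dF_w _ _ _
  have hdual : ∀ i j : Fin 3 × Fin 4,
      dF j.1 j.2 (tF i.2 * X 0 ^ (i.1 : ℕ)) = if i = j then 1 else 0 := by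
    rintro ⟨i, k⟩ ⟨i', k'⟩
    rw [dF_pow]
    simp [Prod.ext_iff, Fin.ext_iff]
  have hpow : ∀ (i : ℕ) (k : Fin 4), Ideal.Quotient.mk jacobianIdealF10 (tF k * X 0 ^ i) ∈
      Submodule.span ℂ (Set.range fun i : Fin 3 × Fin 4 =>
        Ideal.Quotient.mk jacobianIdealF10 (tF i.2 * X 0 ^ (i.1 : ℕ))) := by
    intro i k
    by_cases hi : i < 3
    · exact Submodule.subset_span ⟨(⟨i, hi⟩, k), rfl⟩
    · obtain ⟨j, rfl⟩ := Nat.exists_eq_add_of_le (not_lt.mp hi)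
      have : Ideal.Quotient.mk jacobianIdealF10 (tF k * X 0 ^ (3 + j)) = 0 := by
        rw [smul_eq_zero_iff_right (by norm_num)] at h0
        rw [map_mul, map_pow, pow_add]
        linear_combination (Ideal.Quotient.mk jacobianIdealF10 (tF k) *
          Ideal.Quotient.mk jacobianIdealF10 (X 0) ^ j) * h0
      rw [this]
      exact Submodule.zero_mem _
  have key := quot_dim (ι := Fin 3 × Fin 4) jacobianIdealF10
    (fun i => tF i.2 * X 0 ^ (i.1 : ℕ)) (fun i => dF i.1 i.2) hdim hdual ?_ ?_
  · simpa using key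
  · simpa [tF] using hpow 0 0
  · rintro l ⟨i, k⟩
    dsimp only
    rw [smul_eq_zero_iff_right (by norm_num)] at h1
    have hs : ∀ q : MvPolynomial (Fin 4) ℂ ⧸ jacobianIdealF10, (2 : ℂ) • q = 2 * q := fun q => by
      rw [two_smul, two_mul]
    rw [hs] at h2 h3
    set T := Submodule.span ℂ (Set.range fun i : Fin 3 × Fin 4 =>
        Ideal.Quotient.mk jacobianIdealF10 (tF i.2 * X 0 ^ (i.1 : ℕ))) with hT
    have p1 := hpow i 1
    have p2 := hpow i 2
    have p3 := hpow i 3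
    have p4 := T.smul_mem (-2 : ℂ) p3
    rw [neg_smul, hs] at p4
    have hc : (3 : ℂ) • (Ideal.Quotient.mk jacobianIdealF10 (X 2) *
        Ideal.Quotient.mk jacobianIdealF10 (X 2) * Ideal.Quotient.mk jacobianIdealF10 (X 3)) = 0 := by
      rw [show (3 : ℂ) = 1 + 1 + 1 by norm_num, add_smul, add_smul, one_smul]
      linear_combination 2 * Ideal.Quotient.mk jacobianIdealF10 (X 2) * h2 -
         Ideal.Quotient.mk jacobianIdealF10 (X 3) * h3
    have hc' : (3 : ℂ) • (Ideal.Quotient.mk jacobianIdealF10 (X 2) *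
        Ideal.Quotient.mk jacobianIdealF10 (X 3) * Ideal.Quotient.mk jacobianIdealF10 (X 3)) = 0 := by
      rw [show (3 : ℂ) = 1 + 1 + 1 by norm_num, add_smul, add_smul, one_smul]
      linear_combination 2 * Ideal.Quotient.mk jacobianIdealF10 (X 3) * h3 -
         Ideal.Quotient.mk jacobianIdealF10 (X 2) * h2
    rw [smul_eq_zero_iff_right (by norm_num)] at hc hc'
    fin_cases l
    · have := hpow (i + 1) k
      rwa [pow_succ, ← mul_assoc, map_mul _ _ (X 0)] at this
    · simp [h1]
    · fin_cases k <;>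
        simp only [Fin.zero_eta, Fin.mk_one, Fin.reduceFinMk, tF, Matrix.cons_val, one_mul,
          map_mul] at p1 p2 p3 p4 ⊢
      · convert p1 using 1; simp; ring
      · convert p4 using 1
        linear_combination (Ideal.Quotient.mk jacobianIdealF10 (X 0 ^ (i : ℕ))) * h3
      · convert p3 using 1; ring
      · convert T.zero_mem using 1
        linear_combination (Ideal.Quotient.mk jacobianIdealF10 (X 0 ^ (i : ℕ))) * hc
    · fin_cases k <;>
        simp only [Fin.zero_eta, Fin.mk_one, Fin.reduceFinMk, tF, Matrix.cons_val, one_mul,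
          map_mul] at p1 p2 p3 p4 ⊢
      · convert p2 using 1; simp; ring
      · convert p3 using 1; ring
      · convert p4 using 1
        linear_combination (Ideal.Quotient.mk jacobianIdealF10 (X 0 ^ (i : ℕ))) * h2
      · convert T.zero_mem using 1
        linear_combination (Ideal.Quotient.mk jacobianIdealF10 (X 0 ^ (i : ℕ))) * hc'

lemma cf_pow (i j) : cf i 0 0 0 (X 0 ^ j) = if j = i then 1 else 0 := by
  induction j generalizing i with
  | zero => simp [cf_one, eq_comm]
  | succ j ih =>
    rw [pow_succ]
    cases i with
    | zero => simp [cf_x0]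
    | succ i => simp [cf_x, ih]

lemma cf_pow_zero (n i : ℕ) (h : i < n) (p) : cf i 0 0 0 (p * X 0 ^ n) = 0 := by
  induction n generalizing i with
  | zero => omega
  | succ j ih =>
    rw [pow_succ, ← mul_assoc]
    cases i with
    | zero => simp [cf_x0]
    | succ i => rw [cf_x, ih]; omega

lemma partG : FiniteDimensional ℂ (MvPolynomial (Fin 4) ℂ ⧸ jacobianIdealG10) ∧
      Module.finrank ℂ (MvPolynomial (Fin 4) ℂ ⧸ jacobianIdealG10) = 7 := by
  have hg : ∀ k, Ideal.Quotient.mk jacobianIdealG10 (genG k) = 0 := fun k => by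
    rw [Ideal.Quotient.eq_zero_iff_mem, jacG]
    exact Ideal.subset_span ⟨k, rfl⟩
  have hsm : ∀ (c : ℂ) (p : MvPolynomial (Fin 4) ℂ), Ideal.Quotient.mk jacobianIdealG10 (c • p)
      = c • Ideal.Quotient.mk jacobianIdealG10 p := fun c p => rfl
  have h0 := hg 0
  have h1 := hg 1
  have h2 := hg 2
  have h3 := hg 3
  simp only [genG, Matrix.cons_val, hsm, map_mul] at h0 h1 h2 h3
  rw [smul_eq_zero_iff_right (by norm_num)] at h0 h1
  have hdim : ∀ j : Fin 7, ∀ p ∈ jacobianIdealG10, cf j 0 0 0 p = 0 := by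
    intro i
    refine ideal_le_ker _ genG jacG _ ?_
    intro l p
    fin_cases l
    · have := cf_pow_zero 7 i i.2 p
      simp only [Fin.zero_eta, genG, Matrix.cons_val, mul_smul_comm, map_smul]
      rw [show (X 0 * X 0 * X 0 * X 0 * X 0 * X 0 * X 0 : MvPolynomial (Fin 4) ℂ) = X 0 ^ 7 by ring,
        this, smul_zero]
    · simp [genG, cf_y0]
    · simp [genG, cf_w0]
    · simp [genG, cf_z0]
  have hpow : ∀ (i : ℕ), Ideal.Quotient.mk jacobianIdealG10 (X 0 ^ i) ∈
      Submodule.span ℂ (Set.range fun i : Fin 7 =>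
        Ideal.Quotient.mk jacobianIdealG10 (X 0 ^ (i : ℕ))) := by
    intro i
    by_cases hi : i < 7
    · exact Submodule.subset_span ⟨⟨i, hi⟩, rfl⟩
    · obtain ⟨j, rfl⟩ := Nat.exists_eq_add_of_le (not_lt.mp hi)
      have : Ideal.Quotient.mk jacobianIdealG10 (X 0 ^ (7 + j)) = 0 := by
        rw [map_pow, pow_add]
        linear_combination (Ideal.Quotient.mk jacobianIdealG10 (X 0) ^ j) * h0
      rw [this]
      exact Submodule.zero_mem _
  have key := quot_dim (ι := Fin 7) jacobianIdealG10
    (fun i => X 0 ^ (i : ℕ)) (fun i => cf i 0 0 0) hdim ?_ ?_ ?_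
  · simpa using key
  · intro i j
    rw [cf_pow]
    simp [Fin.ext_iff]
  · simpa using hpow 0
  · intro l i
    fin_cases l
    · have := hpow (i + 1)
      rwa [pow_succ, map_mul] at this
    · simp [h1]
    · simp [h3]
    · simp [h2]

/-- The Milnor numbers of the cDV singularities `x⁴ + y² + z²w + zw² = 0` and
`x⁸ + y² + zw = 0` at the origin are `12` and `7`, respectively: the Jacobian quotient
rings are `ℂ`-vector spaces of dimensions `12` and `7`. -/
theorem milnor_numbers_degree10 :
    (FiniteDimensional ℂ (MvPolynomial (Fin 4) ℂ ⧸ jacobianIdealF10) ∧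
      Module.finrank ℂ (MvPolynomial (Fin 4) ℂ ⧸ jacobianIdealF10) = 12) ∧
    (FiniteDimensional ℂ (MvPolynomial (Fin 4) ℂ ⧸ jacobianIdealG10) ∧
      Module.finrank ℂ (MvPolynomial (Fin 4) ℂ ⧸ jacobianIdealG10) = 7) := 
  ⟨partF, partG⟩
end
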